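/- Let D₁ and D₂ be coprime odd positive integers with D₂ > 1, and let N(D₁,D₂) denote the number of triples (x,m,n) of positive integers satisfying D₁·x² + D₂^m = 2^(n+2). If D₁ = 1, then N(1,D₂) ≤ 1 except for the following cases: N(1,7) = 6, N(1,23) = 2, and N(1, 2^r − 1) = 2 for every integer r > 3. -/

import Mathlib

open Finset

section GeneralizedBinomial

lemma succ_mul_choose_succ (r : ℝ) (k : ℕ) :
    ((k : ℝ) + 1) * Ring.choose r (k + 1) = (r - k) * Ring.choose r k := by
  have h := Ring.choose_smul_choose r (Nat.le_succ k)
  simp only [Nat.succ_eq_add_one, Nat.choose_succ_self_right, nsmul_eq_mul,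
    Nat.add_sub_cancel_left, Ring.choose_one_right] at h
  push_cast at h
  linarith

lemma succ_mul_choose_succ' (r : ℝ) (k : ℕ) :
    ((k : ℝ) + 1) * Ring.choose r (k + 1) = r * Ring.choose (r - 1) k := by
  have h := Ring.choose_smul_choose r (Nat.succ_le_succ (Nat.zero_le k))
  simpa [Ring.choose_one_right] using h

lemma sub_mul_choose (r : ℝ) (k : ℕ) :
    (r - k) * Ring.choose r k = r * Ring.choose (r - 1) k := by
  rw [← succ_mul_choose_succ, succ_mul_choose_succ']

lemma factorial_mul_choose (r : ℝ) (k : ℕ) :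
    (k.factorial : ℝ) * Ring.choose r k = ∏ i ∈ range k, (r - i) := by
  induction k with
  | zero => simp
  | succ k ih =>
    rw [prod_range_succ, ← ih, Nat.factorial_succ]
    push_cast
    linear_combination (k.factorial : ℝ) * succ_mul_choose_succ r k

lemma choose_nonneg_of_sub_nonneg {r : ℝ} {k : ℕ} (h : (k : ℝ) ≤ r + 1) :
    0 ≤ Ring.choose r k := by
  have h1 : 0 ≤ (k.factorial : ℝ) * Ring.choose r k := by
    rw [factorial_mul_choose]
    refine prod_nonneg fun i hi => ?_
    have : (i : ℝ) + 1 ≤ k := by exact_mod_cast mem_range.1 hi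
    linarith
  exact nonneg_of_mul_nonneg_right h1 (by positivity)

lemma sum_choose_mul_choose (r s : ℝ) (k : ℕ) :
    ∑ i ∈ range (k + 1), Ring.choose r i * Ring.choose s (k - i) = Ring.choose (r + s) k := by
  rw [Ring.add_choose_eq k (Commute.all r s),
    Nat.sum_antidiagonal_eq_sum_range_succ (fun i j => Ring.choose r i * Ring.choose s j)]

end GeneralizedBinomial

section Pade

/-- The numerator of the `[p/q]` Padé approximant of `w ^ ν` at `w = 1`. -/
noncomputable def padeP (p q : ℕ) (ν w : ℝ) : ℝ :=
  ∑ a ∈ range (p + 1), Ring.choose (q + ν) a * Ring.choose (p - ν) (p - a) * w ^ a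

/-- The denominator of the `[p/q]` Padé approximant of `w ^ ν` at `w = 1`. -/
noncomputable def padeQ (p q : ℕ) (ν w : ℝ) : ℝ :=
  ∑ l ∈ range (q + 1), Ring.choose (p - ν) l * Ring.choose (q + ν) (q - l) * w ^ l

/-- The remainder of the Padé approximation of `w ^ ν` at `w = 1`. -/
noncomputable def padeR (p q : ℕ) (ν w : ℝ) : ℝ := padeP p q ν w - w ^ ν * padeQ p q ν w

lemma padeP_one (p q : ℕ) (ν : ℝ) : padeP p q ν 1 = (p + q).choose p := by
  simp only [padeP, one_pow, mul_one, sum_choose_mul_choose]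
  rw [show (q : ℝ) + ν + (p - ν) = ((p + q : ℕ) : ℝ) by push_cast; ring, Ring.choose_natCast]

lemma padeQ_one (p q : ℕ) (ν : ℝ) : padeQ p q ν 1 = (p + q).choose q := by
  simp only [padeQ, one_pow, mul_one, sum_choose_mul_choose]
  rw [show (p : ℝ) - ν + (q + ν) = ((p + q : ℕ) : ℝ) by push_cast; ring, Ring.choose_natCast]

lemma padeR_one (p q : ℕ) (ν : ℝ) : padeR p q ν 1 = 0 := by
  rw [padeR, padeP_one, padeQ_one, Real.one_rpow, one_mul, Nat.choose_symm_add, sub_self]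

lemma hasDerivAt_padeP (p q : ℕ) (ν w : ℝ) :
    HasDerivAt (padeP (p + 1) q ν) ((q + ν) * padeP p q (ν - 1) w) w := by
  have h : ∀ a ∈ range (p + 1 + 1), HasDerivAt
      (fun w : ℝ => Ring.choose (q + ν) a * Ring.choose ((p + 1 : ℕ) - ν) (p + 1 - a) * w ^ a)
      (Ring.choose (q + ν) a * Ring.choose ((p + 1 : ℕ) - ν) (p + 1 - a) * (a * w ^ (a - 1))) w :=
    fun a _ => (hasDerivAt_pow a w).const_mul _
  have h2 := HasDerivAt.fun_sum h
  refine h2.congr_deriv ?_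
  rw [sum_range_succ', padeP, mul_sum]
  simp only [Nat.cast_zero, zero_mul, mul_zero, add_zero]
  refine sum_congr rfl fun a _ => ?_
  have e := succ_mul_choose_succ' (q + ν) a
  rw [Nat.add_sub_add_right, Nat.add_sub_cancel,
    show ((p + 1 : ℕ) : ℝ) - ν = p - (ν - 1) by push_cast; ring,
    show (q : ℝ) + (ν - 1) = q + ν - 1 by ring]
  push_cast
  linear_combination (Ring.choose (p - (ν - 1)) (p - a) * w ^ a) * e

lemma hasDerivAt_rpow_mul_padeQ (p q : ℕ) (ν : ℝ) {w : ℝ} (hw : 0 < w) :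
    HasDerivAt (fun w => w ^ ν * padeQ p q ν w)
      ((q + ν) * ∑ l ∈ range (q + 1),
        Ring.choose (p - ν) l * Ring.choose (q + ν - 1) (q - l) * (w ^ (ν - 1) * w ^ l)) w := by
  have h : ∀ l ∈ range (q + 1), HasDerivAt
      (fun w : ℝ => Ring.choose (p - ν) l * Ring.choose (q + ν) (q - l) * (w ^ ν * w ^ l))
      (Ring.choose (p - ν) l * Ring.choose (q + ν) (q - l) *
        (ν * w ^ (ν - 1) * w ^ l + w ^ ν * (l * w ^ (l - 1)))) w :=
    fun l _ => ((Real.hasDerivAt_rpow_const (Or.inl hw.ne')).mul (hasDerivAt_pow l w)).const_mul _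
  have h2 := HasDerivAt.fun_sum h
  have hf : (fun w : ℝ => w ^ ν * padeQ p q ν w) = fun w : ℝ => ∑ l ∈ range (q + 1),
      Ring.choose (p - ν) l * Ring.choose (q + ν) (q - l) * (w ^ ν * w ^ l) := by
    funext w
    rw [padeQ, mul_sum]
    exact sum_congr rfl fun l _ => by ring
  rw [hf]
  refine h2.congr_deriv ?_
  · rw [mul_sum]
    refine sum_congr rfl fun l hl => ?_
    have hl' : l ≤ q := Nat.lt_succ_iff.1 (mem_range.1 hl)
    have e := sub_mul_choose (q + ν) (q - l)
    rw [Nat.cast_sub hl'] at e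
    have e2 : w ^ ν * (l * w ^ (l - 1)) = l * (w ^ (ν - 1) * w ^ l) := by
      rcases l with _ | l
      · simp
      · rw [Real.rpow_sub_one hw.ne', Nat.add_sub_cancel, pow_succ]
        field_simp
    rw [e2]
    linear_combination (Ring.choose (p - ν) l * (w ^ (ν - 1) * w ^ l)) * e

lemma hasDerivAt_padeR_succ (p q : ℕ) (ν : ℝ) {w : ℝ} (hw : 0 < w) :
    HasDerivAt (padeR (p + 1) q ν) ((q + ν) * padeR p q (ν - 1) w) w := by
  have h := (hasDerivAt_padeP p q ν w).fun_sub (hasDerivAt_rpow_mul_padeQ (p + 1) q ν hw)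
  refine h.congr_deriv ?_
  rw [padeR, padeQ, mul_sub, ← mul_assoc (q + ν) (w ^ (ν - 1)), mul_sum, mul_sum]
  congr 1
  refine sum_congr rfl fun l _ => ?_
  rw [show ((p + 1 : ℕ) : ℝ) - ν = p - (ν - 1) by push_cast; ring,
    show (q : ℝ) + (ν - 1) = q + ν - 1 by ring]
  ring

lemma choose_neg_mul_choose (q l : ℕ) (ν : ℝ) (hl : l ≤ q) :
    Ring.choose (-ν) l * Ring.choose (q + ν - 1) (q - l)
      = Ring.choose (q + ν - 1) q * ((-1) ^ l * q.choose l) := by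
  have h := Ring.choose_smul_choose (q + ν - 1) (Nat.sub_le q l)
  rw [Nat.sub_sub_self hl, Nat.choose_symm hl, nsmul_eq_mul, Nat.cast_sub hl,
    show (q : ℝ) + ν - 1 - (q - l) = ν + l - 1 by ring] at h
  have h2 : Ring.choose (-ν) l = (-1) ^ l * Ring.choose (ν + l - 1) l := by
    rw [Ring.choose_neg, Int.negOnePow_def, Units.smul_def]
    simp
  rw [h2]
  linear_combination (-1 : ℝ) ^ l * (-h)

lemma hasDerivAt_padeR_zero (q : ℕ) (ν : ℝ) {w : ℝ} (hw : 0 < w) :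
    HasDerivAt (padeR 0 q ν)
      (-((q + ν) * Ring.choose (q + ν - 1) q * w ^ (ν - 1) * (1 - w) ^ q)) w := by
  have h1 : HasDerivAt (padeP 0 q ν) 0 w := by
    have : padeP 0 q ν = fun _ => 1 := by funext w; simp [padeP]
    rw [this]
    exact hasDerivAt_const _ _
  have h := h1.fun_sub (hasDerivAt_rpow_mul_padeQ 0 q ν hw)
  refine h.congr_deriv ?_
  rw [zero_sub, sub_eq_neg_add 1 w, add_pow, mul_sum, mul_sum]
  congr 1
  refine sum_congr rfl fun l hl => ?_
  have hl' : l ≤ q := Nat.lt_succ_iff.1 (mem_range.1 hl)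
  have e := choose_neg_mul_choose q l ν hl'
  rw [Nat.cast_zero, zero_sub, e, neg_pow w]
  ring

end Pade

lemma abs_le_of_abs_hasDerivAt_le {g g' : ℝ → ℝ} {C w₀ : ℝ} (n : ℕ)
    (hg : ∀ t ∈ Set.Icc w₀ 1, HasDerivAt g (g' t) t)
    (hg' : ∀ t ∈ Set.Icc w₀ 1, |g' t| ≤ C * (1 - t) ^ n) (h1 : g 1 = 0)
    {w : ℝ} (hw : w ∈ Set.Icc w₀ 1) : |g w| ≤ C / (n + 1) * (1 - w) ^ (n + 1) := by
  have key : ∀ s : ℝ, |s| = 1 → 0 ≤ C / (n + 1) * (1 - w) ^ (n + 1) - s * g w := by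
    intro s hs
    have hd : ∀ t ∈ Set.Icc w₀ 1, HasDerivAt
        (fun t => C / (n + 1) * (1 - t) ^ (n + 1) - s * g t) (-(C * (1 - t) ^ n) - s * g' t) t := by
      intro t ht
      have h2 := ((((hasDerivAt_id t).const_sub 1).pow (n + 1)).const_mul (C / (n + 1))).fun_sub
        ((hg t ht).const_mul s)
      refine h2.congr_deriv ?_
      have : (n : ℝ) + 1 ≠ 0 := by positivity
      simp only [id, Nat.add_sub_cancel]
      push_cast
      field_simp
    have hanti : AntitoneOn (fun t => C / (n + 1) * (1 - t) ^ (n + 1) - s * g t)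
        (Set.Icc w₀ 1) := by
      refine antitoneOn_of_hasDerivWithinAt_nonpos (convex_Icc w₀ 1)
        (fun t ht => (hd t ht).continuousAt.continuousWithinAt)
        (fun t ht => (hd t (interior_subset ht)).hasDerivWithinAt) fun t ht => ?_
      have h3 := hg' t (interior_subset ht)
      have h4 : |s * g' t| = |g' t| := by rw [abs_mul, hs, one_mul]
      have := neg_abs_le (s * g' t)
      linarith
    have := hanti hw (Set.right_mem_Icc.2 (hw.1.trans hw.2)) hw.2
    simpa [h1] using this
  rw [abs_le]
  constructor
  · have := key (-1) (by simp)
    linarith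
  · have := key 1 (by simp)
    linarith

lemma abs_padeR_le (p q : ℕ) {ν w₀ : ℝ} (hν : ν ≤ 1) (hw₀ : 0 < w₀) {w : ℝ}
    (hw : w ∈ Set.Icc w₀ 1) :
    |padeR p q ν w| ≤ |(∏ i ∈ range (p + 1), (q + ν - i)) * Ring.choose (q + ν - p - 1) q| *
      w₀ ^ (ν - p - 1) * (q.factorial / (p + q + 1).factorial) * (1 - w) ^ (p + q + 1) := by
  induction p generalizing ν w with
  | zero =>
    have h := abs_le_of_abs_hasDerivAt_le (g := padeR 0 q ν)
      (C := |(q + ν) * Ring.choose (q + ν - 1) q| * w₀ ^ (ν - 1)) (w₀ := w₀) q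
      (fun t ht => hasDerivAt_padeR_zero q ν (hw₀.trans_le ht.1)) (fun t ht => ?_)
      (padeR_one 0 q ν) hw
    · refine h.trans (le_of_eq ?_)
      simp only [zero_add, range_one, prod_singleton, Nat.cast_zero, sub_zero, Nat.factorial_succ]
      have : (q.factorial : ℝ) ≠ 0 := by positivity
      push_cast
      field_simp
    · have h1t : 0 ≤ 1 - t := by linarith [ht.2]
      have ht0 : 0 < t := hw₀.trans_le ht.1
      rw [abs_neg, abs_mul, abs_mul _ (t ^ (ν - 1)), abs_of_nonneg (pow_nonneg h1t q),
        abs_of_nonneg (Real.rpow_nonneg ht0.le _)]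
      gcongr ?_ * ?_ * _
      exact Real.rpow_le_rpow_of_nonpos hw₀ ht.1 (by linarith)
  | succ p ih =>
    have h := abs_le_of_abs_hasDerivAt_le (g := padeR (p + 1) q ν)
      (C := |q + ν| * (|(∏ i ∈ range (p + 1), (q + (ν - 1) - i)) *
        Ring.choose (q + (ν - 1) - p - 1) q| *
      w₀ ^ ((ν - 1) - p - 1) * (q.factorial / (p + q + 1).factorial))) (w₀ := w₀) (p + q + 1)
      (fun t ht => hasDerivAt_padeR_succ p q ν (hw₀.trans_le ht.1)) (fun t ht => ?_)
      (padeR_one (p + 1) q ν) hw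
    · refine h.trans (le_of_eq ?_)
      rw [prod_range_succ' _ (p + 1), show p + 1 + q + 1 = (p + q + 1) + 1 by ring,
        Nat.factorial_succ (p + q + 1), abs_mul, abs_mul, abs_mul]
      have : ((p + q + 1).factorial : ℝ) ≠ 0 := by positivity
      have e1 : ∏ i ∈ range (p + 1), ((q : ℝ) + (ν - 1) - i)
          = ∏ i ∈ range (p + 1), ((q : ℝ) + ν - (i + 1 : ℕ)) :=
        prod_congr rfl fun i _ => by push_cast; ring
      rw [e1]
      push_cast
      rw [show (q : ℝ) + (ν - 1) - p - 1 = q + ν - (p + 1) - 1 by ring,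
        show (ν - 1) - (p : ℝ) - 1 = ν - (p + 1) - 1 by ring, sub_zero]
      field_simp
    · rw [abs_mul, mul_assoc |_|]
      gcongr
      exact ih (by linarith) ht

lemma abs_prod_half_sub_le (q : ℕ) :
    |∏ i ∈ range (q + 1), ((q : ℝ) + 1 / 2 - i)| ≤ (q + 1).factorial := by
  induction q with
  | zero => norm_num
  | succ q ih =>
    rw [prod_range_succ', abs_mul, Nat.factorial_succ, mul_comm]
    push_cast
    simp only [show ∀ a b : ℝ, a + 1 + 1 / 2 - (b + 1) = a + 1 / 2 - b by
      intros; ring]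
    rw [sub_zero, abs_of_nonneg (by positivity : (0 : ℝ) ≤ q + 1 + 1 / 2)]
    gcongr
    linarith

lemma factorial_mul_abs_prod_neg_le (d q : ℕ) :
    (d.factorial : ℝ) * |∏ j ∈ range q, (-(d : ℝ) - 1 / 2 - j)| ≤ (d + q).factorial := by
  induction q with
  | zero => simp
  | succ q ih =>
    rw [prod_range_succ, abs_mul, ← add_assoc, Nat.factorial_succ, ← mul_assoc, mul_comm]
    push_cast
    gcongr
    rw [abs_le]
    constructor <;> linarith [Nat.cast_nonneg (α := ℝ) d, Nat.cast_nonneg (α := ℝ) q]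

lemma abs_padeR_half_coeff_le (q d : ℕ) :
    |(∏ i ∈ range (q + d + 1), ((q : ℝ) + 1 / 2 - i)) *
      Ring.choose ((q : ℝ) + 1 / 2 - (q + d : ℕ) - 1) q| *
      (q.factorial / (q + d + q + 1).factorial) ≤ 1 / ((q + d + q).choose q : ℝ) := by
  have h1 := abs_prod_half_sub_le q
  have h2 : |∏ i ∈ range d, ((q : ℝ) + 1 / 2 - (q + 1 + i : ℕ))| ≤ d.factorial := by
    have := factorial_mul_abs_prod_neg_le 0 d
    simp only [Nat.factorial_zero, Nat.cast_one, one_mul, zero_add, Nat.cast_zero, neg_zero] at this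
    refine le_trans (le_of_eq ?_) this
    congr 1
    refine prod_congr rfl fun i _ => ?_
    push_cast
    ring
  have h3 : (d.factorial : ℝ) * (q.factorial *
      |Ring.choose ((q : ℝ) + 1 / 2 - (q + d : ℕ) - 1) q|) ≤ (q + d).factorial := by
    rw [add_comm q d]
    convert factorial_mul_abs_prod_neg_le d q using 2
    rw [← Nat.abs_cast q.factorial, ← abs_mul, factorial_mul_choose]
    congr 1
    refine prod_congr rfl fun i _ => ?_
    push_cast
    ring
  have h4 : ((q + d + q).choose q : ℝ) * (q.factorial * (q + d).factorial)
      = (q + d + q).factorial := by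
    have := Nat.add_choose_mul_factorial_mul_factorial (q + d) q
    exact_mod_cast (by linarith : _ = _)
  rw [show q + d + 1 = (q + 1) + d by ring, prod_range_add, abs_mul, abs_mul,
    Nat.factorial_succ (q + d + q), le_div_iff₀ (by
      exact_mod_cast Nat.choose_pos (Nat.le_add_left q (q + d))), Nat.cast_mul, ← h4]
  have hc : 0 < ((q + d + q).choose q : ℝ) := by
    exact_mod_cast Nat.choose_pos (Nat.le_add_left q (q + d))
  set A := |∏ i ∈ range (q + 1), ((q : ℝ) + 1 / 2 - i)|
  set B := |∏ i ∈ range d, ((q : ℝ) + 1 / 2 - (q + 1 + i : ℕ))|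
  set c := |Ring.choose ((q : ℝ) + 1 / 2 - (q + d : ℕ) - 1) q|
  have hA : 0 ≤ A := abs_nonneg _
  have hB : 0 ≤ B := abs_nonneg _
  have hcc : 0 ≤ c := abs_nonneg _
  clear_value A B c
  have key : A * B * c * q.factorial ≤ (q + 1) * (q.factorial * (q + d).factorial) := by
    calc A * B * c * q.factorial = A * (B * (q.factorial * c)) := by ring
      _ ≤ (q + 1).factorial * (d.factorial * (q.factorial * c)) := by gcongr
      _ ≤ (q + 1).factorial * (q + d).factorial := by gcongr
      _ = _ := by rw [Nat.factorial_succ]; push_cast; ring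
  have hd : (0 : ℝ) ≤ d := by positivity
  have hq : (0 : ℝ) ≤ q := by positivity
  push_cast at key ⊢
  have hf : (0 : ℝ) < q.factorial * (q + d).factorial := by positivity
  have e : A * B * c * (q.factorial / ((q + d + q + 1) *
      ((q + d + q).choose q * (q.factorial * (q + d).factorial)))) * (q + d + q).choose q
      = (A * B * c * q.factorial) / ((q + d + q + 1) * (q.factorial * (q + d).factorial)) := by
    field_simp
  rw [e, div_le_one (by positivity)]
  refine key.trans ?_
  gcongr
  linarith

lemma abs_padeR_half_le (q d : ℕ) {w : ℝ} (hw : 0 < w) (hw1 : w ≤ 1) :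
    |padeR (q + d) q (1 / 2) w| ≤ 1 / ((q + d + q).choose q : ℝ) *
      w ^ ((1 / 2 : ℝ) - (q + d : ℕ) - 1) * (1 - w) ^ (q + d + q + 1) := by
  refine (abs_padeR_le (q + d) q (by norm_num) hw ⟨le_rfl, hw1⟩).trans ?_
  have h := abs_padeR_half_coeff_le q d
  have h1 : 0 ≤ 1 - w := by linarith
  rw [mul_right_comm |_|]
  gcongr

/-- The integer `4 ^ a * choose (m - 1 / 2) a`. -/
def halfChoose : ℕ → ℕ → ℤ
  | 0, a => (-1) ^ a * a.centralBinom
  | _ + 1, 0 => 1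
  | m + 1, a + 1 => halfChoose m (a + 1) + 4 * halfChoose m a

lemma cast_halfChoose (m a : ℕ) :
    (halfChoose m a : ℝ) = 4 ^ a * Ring.choose ((m : ℝ) - 1 / 2) a := by
  induction m generalizing a with
  | zero =>
    induction a with
    | zero => simp [halfChoose]
    | succ a ih =>
      have h1 := succ_mul_choose_succ (((0 : ℕ) : ℝ) - 1 / 2) a
      have h2 : ((a : ℝ) + 1) * (a + 1).centralBinom = 2 * (2 * a + 1) * a.centralBinom := by
        exact_mod_cast Nat.succ_mul_centralBinom_succ a
      have h3 : (a : ℝ) + 1 ≠ 0 := by positivity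
      refine mul_left_cancel₀ h3 ?_
      simp only [halfChoose] at ih ⊢
      push_cast at ih h1 ⊢
      linear_combination (-1) ^ (a + 1) * h2 - 4 ^ (a + 1) * h1 - 2 * (2 * a + 1) * ih
  | succ m ih =>
    cases a with
    | zero => simp [halfChoose]
    | succ a =>
      have h := Ring.choose_succ_succ ((m : ℝ) - 1 / 2) a
      rw [halfChoose]
      push_cast
      rw [ih, ih, show (m : ℝ) + 1 - 1 / 2 = (m : ℝ) - 1 / 2 + 1 by ring, h]
      ring

lemma factorial_mul_halfChoose (m l : ℕ) :
    (l.factorial : ℤ) * halfChoose m l = 2 ^ l * ∏ i ∈ range l, (2 * (m : ℤ) - 1 - 2 * i) := by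
  have h : ((l.factorial : ℤ) * halfChoose m l : ℝ)
      = (2 ^ l * ∏ i ∈ range l, (2 * (m : ℤ) - 1 - 2 * i) : ℝ) := by
    have h1 := factorial_mul_choose ((m : ℝ) - 1 / 2) l
    rw [cast_halfChoose]
    push_cast
    rw [mul_left_comm, h1, show (4 : ℝ) = 2 * 2 by norm_num, mul_pow, mul_assoc]
    congr 1
    rw [← card_range l, ← prod_const, card_range, ← prod_mul_distrib]
    exact prod_congr rfl fun i _ => by ring
  exact_mod_cast h

def padePInt (p q : ℕ) : ℤ :=
  ∑ a ∈ range (p + 1), halfChoose (q + 1) a * halfChoose p (p - a) *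
    181 ^ (2 * a) * 2 ^ (15 * (p - a))

def padeQInt (p q : ℕ) : ℤ :=
  ∑ l ∈ range (q + 1), halfChoose p l * halfChoose (q + 1) (q - l) *
    181 ^ (2 * l) * 2 ^ (15 * (q - l))

lemma scaled_term {a p : ℕ} (h : a ≤ p) (x y : ℝ) :
    4 ^ a * x * (4 ^ (p - a) * y) * 181 ^ (2 * a) * 2 ^ (15 * (p - a))
      = 2 ^ (17 * p) * (x * y * ((181 : ℝ) ^ 2 / 2 ^ 15) ^ a) := by
  obtain ⟨b, rfl⟩ := Nat.exists_eq_add_of_le h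
  rw [Nat.add_sub_cancel_left, show (4 : ℝ) = 2 ^ 2 by norm_num, div_pow, ← pow_mul, ← pow_mul,
    ← pow_mul, ← pow_mul, show 17 * (a + b) = 2 * a + 2 * b + 15 * a + 15 * b by ring,
    pow_add, pow_add, pow_add]
  field_simp

lemma cast_padePInt (p q : ℕ) :
    (padePInt p q : ℝ) = 2 ^ (17 * p) * padeP p q (1 / 2) (181 ^ 2 / 2 ^ 15) := by
  rw [padePInt, padeP, mul_sum]
  push_cast
  refine sum_congr rfl fun a ha => ?_
  rw [← scaled_term (Nat.lt_succ_iff.1 (mem_range.1 ha)), cast_halfChoose, cast_halfChoose,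
    show ((q + 1 : ℕ) : ℝ) - 1 / 2 = q + 1 / 2 by push_cast; ring]

lemma cast_padeQInt (p q : ℕ) :
    (padeQInt p q : ℝ) = 2 ^ (17 * q) * padeQ p q (1 / 2) (181 ^ 2 / 2 ^ 15) := by
  rw [padeQInt, padeQ, mul_sum]
  push_cast
  refine sum_congr rfl fun a ha => ?_
  rw [← scaled_term (Nat.lt_succ_iff.1 (mem_range.1 ha)), cast_halfChoose, cast_halfChoose,
    show ((q + 1 : ℕ) : ℝ) - 1 / 2 = q + 1 / 2 by push_cast; ring]

lemma odd_prod_two_mul_sub (m l : ℕ) : Odd (∏ i ∈ range l, (2 * (m : ℤ) - 1 - 2 * i)) :=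
  prod_induction _ Odd (fun _ _ => Odd.mul) odd_one fun i _ => ⟨m - 1 - i, by ring⟩

lemma exists_odd_factorial_mul_padeQInt (p q : ℕ) :
    ∃ t : ℤ, Odd t ∧ (q.factorial : ℤ) * padeQInt p q = 2 ^ q * t := by
  set u : ℕ → ℕ → ℤ := fun m l => ∏ i ∈ range l, (2 * (m : ℤ) - 1 - 2 * i) with hu
  have hterm : ∀ l ∈ range (q + 1), (q.factorial : ℤ) * (halfChoose p l *
      halfChoose (q + 1) (q - l) * 181 ^ (2 * l) * 2 ^ (15 * (q - l)))
      = 2 ^ q * (q.choose l * u p l * u (q + 1) (q - l) * 181 ^ (2 * l) * 2 ^ (15 * (q - l))) := by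
    intro l hl
    have hl' : l ≤ q := Nat.lt_succ_iff.1 (mem_range.1 hl)
    have h1 := factorial_mul_halfChoose p l
    have h2 := factorial_mul_halfChoose (q + 1) (q - l)
    have h3 : ((q.choose l * l.factorial * (q - l).factorial : ℕ) : ℤ) = q.factorial := by
      exact_mod_cast Nat.choose_mul_factorial_mul_factorial hl'
    have h4 : (2 : ℤ) ^ q = 2 ^ l * 2 ^ (q - l) := by
      rw [← pow_add, Nat.add_sub_cancel' hl']
    rw [← h3, h4]
    push_cast
    calc _ = q.choose l * (l.factorial * halfChoose p l) *
          ((q - l).factorial * halfChoose (q + 1) (q - l)) * 181 ^ (2 * l) * 2 ^ (15 * (q - l)) := by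
          ring
      _ = _ := by rw [h1, h2]; ring
  refine ⟨_, ?_, by rw [padeQInt, mul_sum, sum_congr rfl hterm, ← mul_sum]⟩
  rw [sum_range_succ]
  refine Even.add_odd (even_sum _ fun l hl => ?_) ?_
  · refine Even.mul_left (Even.pow_of_ne_zero even_two ?_) _
    have := mem_range.1 hl
    omega
  · simp only [Nat.choose_self, Nat.sub_self, mul_zero, pow_zero, mul_one, Nat.cast_one, one_mul]
    exact ((odd_prod_two_mul_sub p q).mul (odd_prod_two_mul_sub (q + 1) 0)).mul
      (Odd.pow (by decide))

lemma pow_twentyone_le_choose (a : ℕ) : 21 ^ a ≤ (7 * a).choose (2 * a) := by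
  induction a with
  | zero => simp
  | succ a ih =>
    rw [show 7 * (a + 1) = 7 * a + 7 by ring, show 2 * (a + 1) = 2 * a + 2 by ring,
      Nat.add_choose_eq, pow_succ]
    calc 21 ^ a * 21 ≤ (7 * a).choose (2 * a) * Nat.choose 7 2 := by
          gcongr
          decide
      _ ≤ _ := single_le_sum (f := fun ij : ℕ × ℕ => (7 * a).choose ij.1 * Nat.choose 7 ij.2)
          (fun _ _ => Nat.zero_le _) (a := (2 * a, 2)) (mem_antidiagonal.2 rfl)

lemma padeQ_half_nonneg_le {p q : ℕ} (hqp : q ≤ p) {w : ℝ} (hw : 0 ≤ w) (hw1 : w ≤ 1) :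
    0 ≤ padeQ p q (1 / 2) w ∧ padeQ p q (1 / 2) w ≤ (p + q).choose q := by
  have hc : ∀ l ∈ range (q + 1),
      0 ≤ Ring.choose ((p : ℝ) - 1 / 2) l * Ring.choose ((q : ℝ) + 1 / 2) (q - l) := by
    intro l hl
    have hl' : l ≤ q := Nat.lt_succ_iff.1 (mem_range.1 hl)
    have h1 : (l : ℝ) ≤ q := by exact_mod_cast hl'
    have h2 : (q : ℝ) ≤ p := by exact_mod_cast hqp
    refine mul_nonneg (choose_nonneg_of_sub_nonneg (by linarith))
      (choose_nonneg_of_sub_nonneg ?_)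
    rw [Nat.cast_sub hl']
    linarith [Nat.cast_nonneg (α := ℝ) l]
  constructor
  · exact sum_nonneg fun l hl => mul_nonneg (hc l hl) (pow_nonneg hw l)
  · rw [← padeQ_one p q (1 / 2)]
    refine sum_le_sum fun l hl => mul_le_mul_of_nonneg_left ?_ (hc l hl)
    rw [one_pow]
    exact pow_le_one₀ hw hw1

lemma abs_padeR_base_le (a : ℕ) :
    |padeR (5 * a) (2 * a) (1 / 2) (181 ^ 2 / 2 ^ 15)| ≤
      1 / 21 ^ a * (2 ^ 15 / 181 ^ 2) ^ (5 * a + 1) * (7 / 2 ^ 15) ^ (7 * a + 1) := by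
  have h := abs_padeR_half_le (2 * a) (3 * a) (w := 181 ^ 2 / 2 ^ 15) (by norm_num) (by norm_num)
  rw [show 2 * a + 3 * a = 5 * a by ring, show 5 * a + 2 * a = 7 * a by ring] at h
  refine h.trans ?_
  have h1 : (21 : ℝ) ^ a ≤ (7 * a).choose (2 * a) := by exact_mod_cast pow_twentyone_le_choose a
  have h2 : ((181 : ℝ) ^ 2 / 2 ^ 15) ^ ((1 / 2 : ℝ) - (5 * a : ℕ) - 1)
      ≤ (2 ^ 15 / 181 ^ 2) ^ (5 * a + 1) := by
    have e : ((2 : ℝ) ^ 15 / 181 ^ 2) ^ (5 * a + 1)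
        = (181 ^ 2 / 2 ^ 15) ^ (-((5 * a + 1 : ℕ) : ℝ)) := by
      rw [Real.rpow_neg (by norm_num), Real.rpow_natCast, ← inv_pow, inv_div]
    rw [e]
    refine Real.rpow_le_rpow_of_exponent_ge (by norm_num) (by norm_num) ?_
    push_cast
    linarith
  rw [show (1 : ℝ) - 181 ^ 2 / 2 ^ 15 = 7 / 2 ^ 15 by norm_num]
  gcongr

lemma remainder_term_le {a j : ℕ} (ha : 20 ≤ a) (hj : j < 53 * a + 53) :
    (2 : ℝ) ^ (8 + j + 17 * (2 * a)) * |padeR (5 * a) (2 * a) (1 / 2) (181 ^ 2 / 2 ^ 15)|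
      ≤ 1 / 2 := by
  calc (2 : ℝ) ^ (8 + j + 17 * (2 * a)) * |padeR (5 * a) (2 * a) (1 / 2) (181 ^ 2 / 2 ^ 15)|
      ≤ 2 ^ (87 * a + 60) *
        (1 / 21 ^ a * (2 ^ 15 / 181 ^ 2) ^ (5 * a + 1) * (7 / 2 ^ 15) ^ (7 * a + 1)) := by
        refine mul_le_mul (pow_le_pow_right₀ (by norm_num) (by omega)) (abs_padeR_base_le a)
          (abs_nonneg _) (by positivity)
    _ = (2 ^ 87 * (1 / 21) * (2 ^ 15 / 181 ^ 2) ^ 5 * (7 / 2 ^ 15) ^ 7) ^ a *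
        (2 ^ 60 * (2 ^ 15 / 181 ^ 2) * (7 / 2 ^ 15)) := by
        rw [mul_pow, mul_pow, mul_pow, ← pow_mul, ← pow_mul, ← pow_mul, pow_succ _ (5 * a),
          pow_succ _ (7 * a), pow_add, one_div_pow]
        ring
    _ ≤ (3 / 20) ^ a * 2 ^ 48 := by
        gcongr <;> norm_num
    _ ≤ (3 / 20) ^ 20 * 2 ^ 48 := by
        exact mul_le_mul_of_nonneg_right
          (pow_le_pow_of_le_one (by norm_num) (by norm_num) ha) (by positivity)
    _ ≤ 1 / 2 := by norm_num

lemma cube_lt_pow {a : ℕ} (ha : 20 ≤ a) : 5792 * (106 * a + 105) ^ 3 < 2 ^ (12 * a) := by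
  have h1 : a < 2 ^ a := Nat.lt_two_pow_self
  calc 5792 * (106 * a + 105) ^ 3 ≤ 5792 * (112 * a) ^ 3 := by
        gcongr
        omega
    _ ≤ 2 ^ 33 * a ^ 3 := by
        rw [mul_pow, ← mul_assoc]
        gcongr
        norm_num
    _ < 2 ^ 33 * (2 ^ a) ^ 3 := by gcongr
    _ = 2 ^ (33 + 3 * a) := by rw [← pow_mul, ← pow_add, mul_comm 3 a]
    _ ≤ 2 ^ (12 * a) := Nat.pow_le_pow_right (by norm_num) (by omega)

lemma padeInt_comb_ne_zero {a j x : ℕ} (hj : 53 * a ≤ j) (hx : Odd x) :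
    2 ^ (8 + j - 51 * a) * padePInt (5 * a) (2 * a) - 181 * x * padeQInt (5 * a) (2 * a) ≠ 0 := by
  intro h
  obtain ⟨t, ht, he⟩ := exists_odd_factorial_mul_padeQInt (5 * a) (2 * a)
  have h1 : (2 : ℤ) ^ (2 * a) * 2 ∣ 2 ^ (2 * a) * (181 * x * t) := by
    rw [← pow_succ]
    refine (pow_dvd_pow 2 (by omega : 2 * a + 1 ≤ 8 + j - 51 * a)).trans ?_
    refine ⟨(2 * a).factorial * padePInt (5 * a) (2 * a), ?_⟩
    linear_combination (-(181 * x : ℤ)) * he - ((2 * a).factorial : ℤ) * h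
  have h2 := Int.dvd_of_mul_dvd_mul_left (by positivity) h1
  have h3 : Odd (181 * x * t : ℤ) :=
    (Odd.mul (by decide) (by exact_mod_cast hx)).mul ht
  exact (Int.not_even_iff_odd.2 h3) (even_iff_two_dvd.2 h2)

lemma gap_of_large {x N j : ℕ} (hx : Odd x) (hj : 1060 ≤ j) (h : x ^ 2 + N = 2 ^ (2 * j + 1)) :
    16 * (2 * j + 1) ^ 3 < N := by
  obtain ⟨a, ha, hja, hja'⟩ : ∃ a, 20 ≤ a ∧ 53 * a ≤ j ∧ j < 53 * a + 53 :=
    ⟨j / 53, by omega, by omega, by omega⟩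
  have hR := remainder_term_le ha hja'
  have hQ := padeQ_half_nonneg_le (p := 5 * a) (q := 2 * a) (by omega) (w := 181 ^ 2 / 2 ^ 15)
    (by norm_num) (by norm_num)
  have hK := padeInt_comb_ne_zero hja hx
  set w : ℝ := 181 ^ 2 / 2 ^ 15 with hw
  set P := padeP (5 * a) (2 * a) (1 / 2) w with hP
  set Q := padeQ (5 * a) (2 * a) (1 / 2) w with hQ'
  have hRd : padeR (5 * a) (2 * a) (1 / 2) w = P - w ^ (1 / 2 : ℝ) * Q := rfl
  have hsw : w ^ (1 / 2 : ℝ) * 2 ^ 8 = 181 * √2 := by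
    rw [← Real.sqrt_eq_rpow, hw, show (181 : ℝ) ^ 2 / 2 ^ 15 = (181 / 2 ^ 8) ^ 2 * 2 by norm_num,
      Real.sqrt_mul (by positivity), Real.sqrt_sq (by positivity)]
    ring
  have hs2 : √2 ^ 2 = (2 : ℝ) := Real.sq_sqrt (by norm_num)
  have hspos : 0 ≤ √2 := Real.sqrt_nonneg 2
  have hs1 : 1 ≤ √2 := Real.one_le_sqrt.2 (by norm_num)
  set lam : ℝ := 2 ^ j * √2 - x with hlam
  have hxN : (x : ℝ) ^ 2 + N = 2 ^ (2 * j + 1) := by exact_mod_cast h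
  have h2j : (0 : ℝ) < 2 ^ j := by positivity
  have hprod : lam * (2 ^ j * √2 + x) = N := by
    rw [hlam]
    have : (2 : ℝ) ^ (2 * j + 1) = (2 ^ j) ^ 2 * 2 := by rw [← pow_mul, pow_succ, mul_comm j]
    linear_combination (2 ^ j) ^ 2 * hs2 - hxN + this
  have hx0 : (0 : ℝ) ≤ x := by positivity
  have hsum : 2 ^ j ≤ 2 ^ j * √2 + x := by nlinarith
  have hlam0 : 0 ≤ lam := by
    by_contra hneg
    have : lam * (2 ^ j * √2 + x) < 0 := mul_neg_of_neg_of_pos (not_le.1 hneg) (by linarith)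
    have : (0 : ℝ) ≤ N := by positivity
    linarith
  have hlamN : lam * 2 ^ j ≤ N := by
    rw [← hprod]
    gcongr
  have hKR : ((2 ^ (8 + j - 51 * a) * padePInt (5 * a) (2 * a)
      - 181 * x * padeQInt (5 * a) (2 * a) : ℤ) : ℝ)
      = 2 ^ (8 + j + 17 * (2 * a)) * padeR (5 * a) (2 * a) (1 / 2) w
        + 181 * lam * 2 ^ (17 * (2 * a)) * Q := by
    push_cast
    rw [cast_padePInt, cast_padeQInt, ← hw, ← hP, ← hQ', hRd, hlam, ← mul_assoc, ← pow_add,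
      show 8 + j - 51 * a + 17 * (5 * a) = 8 + j + 17 * (2 * a) by omega,
      show 8 + j + 17 * (2 * a) = 8 + (j + 17 * (2 * a)) by ring, pow_add 2 8,
      pow_add 2 j]
    linear_combination (2 ^ j * 2 ^ (17 * (2 * a)) * Q) * hsw
  have hK1 : (1 : ℝ) ≤ |((2 ^ (8 + j - 51 * a) * padePInt (5 * a) (2 * a)
      - 181 * x * padeQInt (5 * a) (2 * a) : ℤ) : ℝ)| := by
    rw [← Int.cast_abs]
    exact_mod_cast Int.one_le_abs hK
  rw [hKR] at hK1
  have hK2 := hK1.trans (abs_add_le _ _)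
  rw [abs_mul, abs_of_nonneg (by positivity : (0 : ℝ) ≤ 2 ^ (8 + j + 17 * (2 * a))),
    abs_of_nonneg (by
      have := hQ.1
      positivity : 0 ≤ 181 * lam * 2 ^ (17 * (2 * a)) * Q)] at hK2
  have hQ7 : Q ≤ 2 ^ (7 * a) := by
    refine hQ.2.trans ?_
    rw [show 5 * a + 2 * a = 7 * a by ring]
    exact_mod_cast Nat.choose_le_two_pow (7 * a) (2 * a)
  have hN1 : 1 / 2 ≤ 181 * lam * 2 ^ (17 * (2 * a)) * 2 ^ (7 * a) := by
    have : 181 * lam * 2 ^ (17 * (2 * a)) * Q ≤ 181 * lam * 2 ^ (17 * (2 * a)) * 2 ^ (7 * a) := by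
      gcongr
    linarith
  have hN2 : (2 : ℝ) ^ (12 * a) ≤ 362 * N := by
    have e1 : (2 : ℝ) ^ (53 * a) ≤ 2 ^ j := pow_le_pow_right₀ (by norm_num) hja
    have e2 : (2 : ℝ) ^ (53 * a) = 2 ^ (12 * a) * 2 ^ (41 * a) := by
      rw [← pow_add]
      ring_nf
    have e3 : (2 : ℝ) ^ (17 * (2 * a)) * 2 ^ (7 * a) = 2 ^ (41 * a) := by
      rw [← pow_add]
      ring_nf
    have hp : (0 : ℝ) < 2 ^ (41 * a) := by positivity
    have e4 : (2 : ℝ) ^ j ≤ 362 * (lam * 2 ^ j) * 2 ^ (41 * a) := by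
      rw [← e3]
      nlinarith
    have e5 : 362 * (lam * 2 ^ j) * 2 ^ (41 * a) ≤ 362 * N * 2 ^ (41 * a) := by gcongr
    have e6 : (2 : ℝ) ^ (12 * a) * 2 ^ (41 * a) ≤ 362 * N * 2 ^ (41 * a) := by linarith
    exact le_of_mul_le_mul_right e6 hp
  have hN3 : 2 ^ (12 * a) ≤ 362 * N := by exact_mod_cast hN2
  have h5 := cube_lt_pow ha
  have h6 : (2 * j + 1) ^ 3 ≤ (106 * a + 105) ^ 3 := Nat.pow_le_pow_left (by omega) 3
  omega

/-- Starting from `s ^ 2 + d = 2 ^ (2 * j + 1)` with `d ≤ 2 * s`, check `16 * (2 * i + 1) ^ 3 < N`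
for the smallest `N` of the form `2 ^ (2 * i + 1) - x ^ 2`, for `fuel` consecutive values of `i`. -/
def gapCheck : ℕ → ℕ → ℕ → ℕ → Bool
  | 0, _, _, _ => true
  | fuel + 1, j, s, d => Nat.blt (16 * (2 * j + 1) ^ 3) d &&
      bif Nat.ble (4 * s + 1) (4 * d) then gapCheck fuel (j + 1) (2 * s + 1) (4 * d - (4 * s + 1))
      else gapCheck fuel (j + 1) (2 * s) (4 * d)

lemma gap_of_gapCheck (fuel : ℕ) {j s d : ℕ} (hc : gapCheck fuel j s d = true)
    (hsd : s ^ 2 + d = 2 ^ (2 * j + 1)) (hd : d ≤ 2 * s) {i x N : ℕ} (hji : j ≤ i)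
    (hij : i < j + fuel) (h : x ^ 2 + N = 2 ^ (2 * i + 1)) : 16 * (2 * i + 1) ^ 3 < N := by
  induction fuel generalizing j s d with
  | zero => omega
  | succ fuel ih =>
    rw [gapCheck, Bool.and_eq_true] at hc
    obtain ⟨hc1, hc2⟩ := hc
    have hc1' : 16 * (2 * j + 1) ^ 3 < d := by simpa [Nat.blt] using hc1
    have hp : (2 : ℕ) ^ (2 * (j + 1) + 1) = 4 * 2 ^ (2 * j + 1) := by
      rw [show 2 * (j + 1) + 1 = 2 * j + 1 + 2 by ring, pow_add]
      ring
    rcases hji.eq_or_lt with rfl | hlt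
    · have hxs : x < s + 1 := by
        refine lt_of_pow_lt_pow_left₀ 2 (Nat.zero_le _) ?_
        nlinarith
      have : x ^ 2 ≤ s ^ 2 := Nat.pow_le_pow_left (Nat.lt_succ_iff.1 hxs) 2
      omega
    · cases hb : Nat.ble (4 * s + 1) (4 * d) with
      | true =>
        rw [hb, cond_true] at hc2
        have hb' := Nat.le_of_ble_eq_true hb
        refine ih hc2 ?_ (by omega) hlt (by omega)
        zify [hb']
        zify at hsd hp
        rw [hp, ← hsd]
        ring
      | false =>
        rw [hb, cond_false] at hc2
        have hb' : ¬ 4 * s + 1 ≤ 4 * d := fun h => by simp [Nat.ble_eq_true_of_le h] at hb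
        refine ih hc2 ?_ (by omega) hlt (by omega)
        rw [hp, ← hsd]
        ring

set_option maxRecDepth 100000 in
lemma gapCheck_base : gapCheck 1040 20 1482910 1187452 = true := by
  decide +kernel

lemma cube_lt_two_pow {j : ℕ} (hj : 21 ≤ j) : 16 * (2 * j) ^ 3 + 1 < 2 ^ (j + 1) := by
  induction j, hj using Nat.le_induction with
  | base => norm_num
  | succ j hj ih =>
    rw [pow_succ]
    have h1 : 21 * j ^ 2 ≤ j ^ 3 := by rw [pow_succ j 2, mul_comm]; gcongr
    have h2 : 21 * j ≤ j ^ 2 := by rw [sq]; gcongr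
    ring_nf at ih ⊢
    omega

theorem gap {x N k : ℕ} (hx : Odd x) (hN : 0 < N) (hk : 41 ≤ k) (h : x ^ 2 + N = 2 ^ k) :
    16 * k ^ 3 < N := by
  rcases Nat.even_or_odd' k with ⟨j, rfl | rfl⟩
  · have h1 : x < 2 ^ j := by
      refine lt_of_pow_lt_pow_left₀ 2 (Nat.zero_le _) ?_
      rw [← pow_mul, mul_comm j]
      omega
    have h2 := cube_lt_two_pow (j := j) (by omega)
    have h3 : (2 : ℕ) ^ (2 * j) = (2 ^ j) ^ 2 := by rw [← pow_mul, mul_comm]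
    rw [pow_succ 2 j] at h2
    obtain ⟨m, hm⟩ := Nat.exists_eq_add_of_lt h1
    have h4 : x ^ 2 ≤ (x + m) ^ 2 := Nat.pow_le_pow_left (Nat.le_add_right x m) 2
    have h5 : (2 ^ j) ^ 2 = (x + m) ^ 2 + 2 * (x + m) + 1 := by rw [hm]; ring
    omega
  · rcases lt_or_ge j 1060 with hj | hj
    · exact gap_of_gapCheck 1040 gapCheck_base (by norm_num) (by norm_num) (by omega) (by omega) h
    · exact gap_of_large hx hj h

/-- The Lucas sequence with parameters `P` and `Q`. -/
def lucas (P Q : ℤ) : ℕ → ℤ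
  | 0 => 0
  | 1 => 1
  | n + 2 => P * lucas P Q (n + 1) - Q * lucas P Q n

lemma lucas_add_two (P Q : ℤ) (n : ℕ) :
    lucas P Q (n + 2) = P * lucas P Q (n + 1) - Q * lucas P Q n := rfl

lemma lucas_norm (P Q : ℤ) (n : ℕ) :
    lucas P Q (n + 1) ^ 2 - P * lucas P Q (n + 1) * lucas P Q n + Q * lucas P Q n ^ 2 = Q ^ n := by
  induction n with
  | zero => simp [lucas]
  | succ n ih =>
    rw [lucas_add_two, pow_succ]
    linear_combination Q * ih

lemma exists_sq_add_mul_lucas_sq {P Q E : ℤ} (h : P ^ 2 + E = 4 * Q) (n : ℕ) :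
    (2 * lucas P Q (n + 1) - P * lucas P Q n) ^ 2 + E * lucas P Q n ^ 2 = 4 * Q ^ n := by
  linear_combination 4 * lucas_norm P Q n + (lucas P Q n) ^ 2 * h

lemma exists_lucas_eq_mod_sq_disc {P Q E : ℤ} (h : P ^ 2 + E = 4 * Q) (n : ℕ) :
    ∃ c, P ^ 2 * (2 ^ n * lucas P Q (n + 1))
      = (n + 1) * P ^ (n + 2) - ((n + 1).choose 3 : ℤ) * P ^ n * E + E ^ 2 * c := by
  induction n using Nat.twoStepInduction with
  | zero => exact ⟨0, by simp [lucas, Nat.choose]⟩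
  | one => exact ⟨0, by simp [lucas, Nat.choose]; ring⟩
  | more n ih1 ih2 =>
    obtain ⟨c1, h1⟩ := ih1
    obtain ⟨c2, h2⟩ := ih2
    have hc1 : ((n + 3).choose 3 : ℤ) = (n + 2).choose 2 + (n + 2).choose 3 := by
      exact_mod_cast Nat.choose_succ_succ (n + 2) 2
    have hc2 : ((n + 2).choose 3 : ℤ) = (n + 1).choose 2 + (n + 1).choose 3 := by
      exact_mod_cast Nat.choose_succ_succ (n + 1) 2
    have hc3 : ((n + 2).choose 2 : ℤ) = (n + 1 : ℕ) + (n + 1).choose 2 := by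
      have := Nat.choose_succ_succ (n + 1) 1
      rw [Nat.choose_one_right] at this
      exact_mod_cast this
    refine ⟨2 * P * c2 - 4 * Q * c1 + ((n + 1).choose 3 : ℤ) * P ^ n, ?_⟩
    rw [show n + 1 + 1 = n + 2 by rfl] at h2
    rw [show n + 2 + 1 = n + 1 + 2 by rfl, lucas_add_two, show n + 1 + 2 = n + 3 by rfl, hc1, hc3]
    rw [hc2] at h2
    rw [hc2]
    push_cast at h2 ⊢
    rw [show n + 1 + 1 = n + 2 by rfl]
    linear_combination 2 * P * h2 - 4 * Q * h1
      + ((n + 1) * P ^ (n + 2) - ((n + 1).choose 3 : ℤ) * P ^ n * E) * h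

lemma exists_lucas_eq_mod_sq (P Q : ℤ) (n : ℕ) :
    ∃ c, lucas P Q (n + 3) = P ^ (n + 2) - (n + 1) * P ^ n * Q + Q ^ 2 * c := by
  induction n using Nat.twoStepInduction with
  | zero => exact ⟨0, by simp [lucas]; ring⟩
  | one => exact ⟨0, by simp [lucas]; ring⟩
  | more n ih1 ih2 =>
    obtain ⟨c1, h1⟩ := ih1
    obtain ⟨c2, h2⟩ := ih2
    refine ⟨P * c2 - Q * c1 + (n + 1) * P ^ n, ?_⟩
    rw [show n + 2 + 3 = n + 3 + 2 by rfl, lucas_add_two, h1, show n + 3 + 1 = n + 1 + 3 by rfl, h2]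
    push_cast
    ring

def lucasAux (P Q : ℤ) : ℕ → ℤ → ℤ → ℤ
  | 0, a, _ => a
  | n + 1, a, b => lucasAux P Q n b (P * b - Q * a)

lemma lucasAux_lucas (P Q : ℤ) (n m : ℕ) :
    lucasAux P Q n (lucas P Q m) (lucas P Q (m + 1)) = lucas P Q (m + n) := by
  induction n generalizing m with
  | zero => rfl
  | succ n ih => rw [lucasAux, ← lucas_add_two, ih]; congr 1; ring

lemma lucas_eq_lucasAux (P Q : ℤ) (n : ℕ) : lucas P Q n = lucasAux P Q n 0 1 := by
  have := lucasAux_lucas P Q n 0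
  rw [zero_add n] at this
  exact this.symm

set_option synthInstance.maxHeartbeats 400000 in
set_option synthInstance.maxSize 1000 in
lemma lucas_small_cases : ∀ q < 39, ∀ Z < 8, ∀ p < 23,
    5 ≤ q ∧ 0 < Z ∧ q * Z ≤ 38 ∧ q.Prime ∧ p ^ 2 < 2 ^ (Z + 2) ∧ p % 2 = 1 ∧
    (lucasAux (p : ℕ) (2 ^ Z) q 0 1 = 1 ∨ lucasAux (p : ℕ) (2 ^ Z) q 0 1 = -1 ∨
      lucasAux (p : ℕ) (2 ^ Z) q 0 1 = q) →
    p = 1 ∧ (Z = 1 ∧ (q = 5 ∨ q = 7 ∨ q = 13) ∨ Z = 2 ∧ q = 5) := by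
  decide +kernel

lemma lucas_neg (P Q : ℤ) (n : ℕ) : lucas (-P) Q n = (-1) ^ (n + 1) * lucas P Q n := by
  induction n using Nat.twoStepInduction with
  | zero => simp [lucas]
  | one => simp [lucas]
  | more n ih1 ih2 =>
    rw [lucas_add_two, ih1, ih2, lucas_add_two]
    ring

lemma lucas_natAbs (P Q : ℤ) {n : ℕ} (hn : Odd n) : lucas P.natAbs Q n = lucas P Q n := by
  rcases Int.natAbs_eq P with h | h
  · rw [← h]
  · conv_rhs => rw [h, lucas_neg, hn.add_one.neg_one_pow, one_mul]

lemma Int.eq_one_or_neg_one_of_no_prime_dvd {u : ℤ} (h : ∀ l : ℕ, l.Prime → ¬ (l : ℤ) ∣ u) :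
    u = 1 ∨ u = -1 := by
  have : u.natAbs = 1 := by
    by_contra hne
    obtain ⟨l, hl, hlu⟩ := Nat.exists_prime_and_dvd hne
    exact h l hl (Int.natCast_dvd.2 hlu)
  omega

lemma not_dvd_of_sq_add_eq_two_pow {P E : ℤ} {k l : ℕ} (hE : Odd E) (h : P ^ 2 + E = 2 ^ k)
    (hl : l.Prime) (hlE : (l : ℤ) ∣ E) : ¬ (l : ℤ) ∣ P := by
  intro hlP
  have h1 : (l : ℤ) ∣ 2 ^ k := h ▸ dvd_add (dvd_pow hlP two_ne_zero) hlE
  have h2 : l = 2 := by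
    have := (Nat.Prime.dvd_of_dvd_pow hl (by exact_mod_cast h1 : l ∣ 2 ^ k))
    exact (Nat.prime_dvd_prime_iff_eq hl Nat.prime_two).1 this
  subst h2
  exact (Int.not_even_iff_odd.2 hE) (even_iff_two_dvd.2 hlE)

lemma lucas_eq_one_or_neg_one_or_self {P E : ℤ} {Z q : ℕ} (hq : q.Prime) (h5 : 5 ≤ q)
    (hE : Odd E) (h : P ^ 2 + E = 2 ^ (Z + 2))
    (hdvd : ∀ l : ℕ, l.Prime → (l : ℤ) ∣ lucas P (2 ^ Z) q → (l : ℤ) ∣ E) :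
    lucas P (2 ^ Z) q = 1 ∨ lucas P (2 ^ Z) q = -1 ∨ lucas P (2 ^ Z) q = q := by
  obtain ⟨n, rfl⟩ : ∃ n, q = n + 1 := ⟨q - 1, by omega⟩
  obtain ⟨c, hc⟩ := exists_lucas_eq_mod_sq_disc (P := P) (Q := 2 ^ Z) (E := E)
    (by rw [h, pow_add]; ring) n
  set U := lucas P (2 ^ Z) (n + 1)
  have hself : ∀ l : ℕ, l.Prime → (l : ℤ) ∣ U → l = n + 1 := by
    intro l hl hlU
    have hlE := hdvd l hl hlU
    have hlP := not_dvd_of_sq_add_eq_two_pow hE h hl hlE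
    have h1 : (l : ℤ) ∣ ((n + 1 : ℕ) : ℤ) * P ^ (n + 2) := by
      have : ((n + 1 : ℕ) : ℤ) * P ^ (n + 2) = U * (P ^ 2 * 2 ^ n)
          + E * (((n + 1).choose 3 : ℤ) * P ^ n - E * c) := by
        push_cast
        linear_combination -hc
      rw [this]
      exact dvd_add (hlU.mul_right _) (hlE.mul_right _)
    rcases (Nat.prime_iff_prime_int.1 hl).dvd_or_dvd h1 with h2 | h2
    · exact (Nat.prime_dvd_prime_iff_eq hl hq).1 (by exact_mod_cast h2)
    · exact absurd ((Nat.prime_iff_prime_int.1 hl).dvd_of_dvd_pow h2) hlP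
  by_cases hqU : ((n + 1 : ℕ) : ℤ) ∣ U
  · obtain ⟨u, hu⟩ := hqU
    obtain ⟨e, he⟩ := hdvd _ hq ⟨u, hu⟩
    have hqP := not_dvd_of_sq_add_eq_two_pow hE h hq ⟨e, he⟩
    have hqp := Nat.prime_iff_prime_int.1 hq
    obtain ⟨b, hb⟩ : n + 1 ∣ (n + 1).choose 3 := hq.dvd_choose_self (by norm_num) (by omega)
    have hb' : ((n + 1).choose 3 : ℤ) = ((n + 1 : ℕ) : ℤ) * b := by exact_mod_cast hb
    have hq0 : ((n + 1 : ℕ) : ℤ) ≠ 0 := by positivity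
    have key : P ^ 2 * 2 ^ n * u = P ^ (n + 2) + ((n + 1 : ℕ) : ℤ) * (e ^ 2 * c - b * P ^ n * e) := by
      refine mul_left_cancel₀ hq0 ?_
      rw [hu, hb', he] at hc
      push_cast at hc ⊢
      linear_combination hc
    have hu1 : u = 1 ∨ u = -1 := by
      refine Int.eq_one_or_neg_one_of_no_prime_dvd fun l hl hlu => ?_
      obtain rfl := hself l hl (hu ▸ hlu.mul_left _)
      have : ((n + 1 : ℕ) : ℤ) ∣ P ^ (n + 2) := by
        rw [show P ^ (n + 2) = P ^ 2 * 2 ^ n * u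
          - ((n + 1 : ℕ) : ℤ) * (e ^ 2 * c - b * P ^ n * e) by rw [key]; ring]
        exact dvd_sub (hlu.mul_left _) (dvd_mul_right _ _)
      exact hqP (hqp.dvd_of_dvd_pow this)
    rcases hu1 with rfl | rfl
    · right; right
      rw [hu, mul_one]
    · exfalso
      have hq2 : ¬ ((n + 1 : ℕ) : ℤ) ∣ 2 := fun h2 => by
        have := Int.le_of_dvd (by norm_num) h2
        push_cast at this
        omega
      have f1 : ∀ a : ℤ, ¬ ((n + 1 : ℕ) : ℤ) ∣ a → ((n + 1 : ℕ) : ℤ) ∣ a ^ n - 1 := by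
        intro a ha
        have := Int.ModEq.pow_card_sub_one_eq_one hq
          ((hqp.coprime_iff_not_dvd.2 ha).symm : IsCoprime a _)
        exact this.symm.dvd
      have h2 : ((n + 1 : ℕ) : ℤ) ∣ 2 * P ^ 2 := by
        have : 2 * P ^ 2 = - (P ^ 2 * (2 ^ n - 1)) - P ^ 2 * (P ^ n - 1)
            - ((n + 1 : ℕ) : ℤ) * (e ^ 2 * c - b * P ^ n * e) := by
          linear_combination -key
        rw [this]
        exact dvd_sub (dvd_sub (dvd_neg.2 ((f1 2 hq2).mul_left _)) ((f1 P hqP).mul_left _))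
          (dvd_mul_right _ _)
      rcases hqp.dvd_or_dvd h2 with h3 | h3
      · exact hq2 h3
      · exact hqP (hqp.dvd_of_dvd_pow h3)
  · have : U = 1 ∨ U = -1 := Int.eq_one_or_neg_one_of_no_prime_dvd fun l hl hlU =>
      hqU (hself l hl hlU ▸ hlU)
    tauto

lemma two_pow_succ_dvd_pow_sub_one {P : ℤ} (hP : Odd P) {t m : ℕ} (ht : 1 ≤ t) (hm : 2 ^ t ∣ m) :
    (2 : ℤ) ^ (t + 1) ∣ P ^ m - 1 := by
  obtain ⟨o, rfl⟩ := hm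
  have h1 : (2 : ℤ) ^ (t + 1) ∣ P ^ 2 ^ t - 1 := by
    clear o
    induction t, ht using Nat.le_induction with
    | base =>
      have := Int.eight_dvd_sq_sub_one_of_odd hP
      exact (by norm_num : (2 : ℤ) ^ (1 + 1) ∣ 8).trans (by simpa using this)
    | succ t ht ih =>
      rw [pow_succ 2 t, pow_mul, show (P ^ 2 ^ t) ^ 2 - 1 = (P ^ 2 ^ t - 1) * (P ^ 2 ^ t + 1) by ring,
        pow_succ 2 (t + 1)]
      exact mul_dvd_mul ih (even_iff_two_dvd.1 (hP.pow.add_one))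
  rw [pow_mul]
  exact h1.trans (sub_one_dvd_pow_sub_one _ _)

lemma two_pow_dvd_of_lucas_eq_self {P : ℤ} {Z n : ℕ} (hP : Odd P) (hn : Even n)
    (h : lucas P (2 ^ Z) (n + 3) = ((n + 3 : ℕ) : ℤ)) : 2 ^ Z ∣ n + 2 := by
  obtain ⟨c, hc⟩ := exists_lucas_eq_mod_sq P (2 ^ Z) n
  rw [h] at hc
  have key : ∀ z ≤ Z, 2 ^ z ∣ n + 2 := by
    intro z
    induction z with
    | zero => simp
    | succ z ih =>
      intro hz
      rcases Nat.eq_zero_or_pos z with rfl | hz0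
      · simpa using even_iff_two_dvd.1 (hn.add even_two)
      · have h1 := two_pow_succ_dvd_pow_sub_one hP hz0 (ih (by omega))
        have h2 : (2 : ℤ) ^ (z + 1) ∣ 2 ^ Z := pow_dvd_pow 2 hz
        have h3 : (2 : ℤ) ^ (z + 1) ∣ ((n + 2 : ℕ) : ℤ) := by
          have : ((n + 2 : ℕ) : ℤ) = (P ^ (n + 2) - 1) + 2 ^ Z * (2 ^ Z * c - (n + 1) * P ^ n) := by
            push_cast at hc ⊢
            linear_combination hc
          rw [this]
          exact dvd_add h1 (h2.mul_right _)
        exact_mod_cast h3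
  exact key Z le_rfl

lemma two_pow_le_of_two_mul_dvd_sq_sub_one_mul {P : ℤ} (hP : Odd P) (hP1 : P ≠ 1) (hP2 : P ≠ -1)
    {Z n : ℕ} (hn : 0 < n) (h : (2 : ℤ) ^ (Z + 1) ∣ (P + 1) * (P - 1) * n) :
    (2 : ℤ) ^ Z ≤ (|P| + 1) * n := by
  have hn' : (0 : ℤ) < n := by exact_mod_cast hn
  have aux : ∀ o u : ℤ, Odd o → u ≠ 0 → |u| ≤ |P| + 1 → (2 : ℤ) ^ (Z + 1) ∣ 2 * o * u * n →
      (2 : ℤ) ^ Z ≤ (|P| + 1) * n := by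
    intro o u ho hu hle hd
    rw [pow_succ', mul_assoc 2 o, mul_assoc 2, mul_assoc o] at hd
    have h1 := Int.dvd_of_mul_dvd_mul_left two_ne_zero hd
    have h2 : IsCoprime ((2 : ℤ) ^ Z) o := IsCoprime.pow_left (Int.isCoprime_two_left.2 ho)
    have h3 := h2.dvd_of_dvd_mul_left h1
    have h4 := Int.le_of_dvd (abs_pos.2 (mul_ne_zero hu hn'.ne')) ((dvd_abs _ _).2 h3)
    rw [abs_mul, abs_of_pos hn'] at h4
    exact h4.trans (by gcongr)
  obtain ⟨m, rfl⟩ := hP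
  rcases Int.even_or_odd m with hm | hm
  · refine aux (m + 1) (2 * m) hm.add_one (by omega) ?_ (by convert h using 1; ring)
    have := abs_add_le (2 * m + 1) (-1)
    simpa using this
  · refine aux m (2 * m + 2) hm (by omega) ?_ (by convert h using 1; ring)
    have := abs_add_le (2 * m + 1) 1
    simpa [add_assoc] using this

lemma two_pow_le_of_lucas_eq_one {P : ℤ} {Z n : ℕ} (hZ : 1 ≤ Z) (hP : Odd P) (hn : Even n)
    (h : lucas P (2 ^ Z) (n + 3) = 1) : (2 : ℤ) ^ Z ≤ (|P| + 1) * (n + 2) := by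
  obtain ⟨c, hc⟩ := exists_lucas_eq_mod_sq P (2 ^ Z) n
  rw [h] at hc
  have hQ0 : (2 : ℤ) ^ Z ≠ 0 := by positivity
  have hQe : Even ((2 : ℤ) ^ Z) := even_two.pow_of_ne_zero (by omega)
  have hne : ∀ s : ℤ, s ^ 2 = 1 → P ≠ s := by
    rintro s hs rfl
    obtain ⟨m, hm⟩ := hn.exists_two_nsmul
    rw [smul_eq_mul] at hm
    have hn1 : P ^ n = 1 := by rw [hm, pow_mul, hs, one_pow]
    have h1 : (2 : ℤ) ^ Z * (2 ^ Z * c) = 2 ^ Z * (n + 1) := by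
      rw [pow_add, hs, hn1] at hc
      linear_combination -hc
    have h2 := mul_left_cancel₀ hQ0 h1
    have h3 : Even ((n : ℤ) + 1) := h2 ▸ hQe.mul_right c
    have h4 : Even (n : ℤ) := by exact_mod_cast hn
    exact (Int.not_even_iff_odd.2 h4.add_one) h3
  have h2 : ¬ (2 : ℤ) ∣ P := fun h2 => (Int.not_even_iff_odd.2 hP) (even_iff_two_dvd.2 h2)
  have hlte := Int.two_pow_sub_pow (x := P) (y := 1) (n := n + 2)
    (even_iff_two_dvd.1 (hP.sub_odd odd_one)) h2 (hn.add even_two)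
  rw [one_pow] at hlte
  have h3 : (2 : ℤ) ^ Z ∣ P ^ (n + 2) - 1 :=
    ⟨(n + 1) * P ^ n - 2 ^ Z * c, by linear_combination -hc⟩
  have h4 := le_emultiplicity_of_pow_dvd h3
  have h5 : (2 : ℤ) ^ (Z + 1) ∣ (P + 1) * (P - 1) * (n + 2 : ℕ) := by
    rw [pow_dvd_iff_le_emultiplicity, emultiplicity_mul Int.prime_two,
      emultiplicity_mul Int.prime_two, ← hlte]
    push_cast
    gcongr
  have := two_pow_le_of_two_mul_dvd_sq_sub_one_mul hP (hne 1 (by norm_num)) (hne (-1) (by norm_num))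
    (by omega) h5
  exact_mod_cast this

lemma lucas_ne_neg_one {P : ℤ} {Z n : ℕ} (hZ : 2 ≤ Z) (hP : Odd P) (hn : Even n) :
    lucas P (2 ^ Z) (n + 3) ≠ -1 := by
  intro h
  obtain ⟨c, hc⟩ := exists_lucas_eq_mod_sq P (2 ^ Z) n
  rw [h] at hc
  have h1 := two_pow_succ_dvd_pow_sub_one hP le_rfl (m := n + 2)
    (by simpa using even_iff_two_dvd.1 (hn.add even_two))
  have h2 : (2 : ℤ) ^ 2 ∣ 2 ^ Z := pow_dvd_pow 2 hZ
  have h3 : (2 : ℤ) ^ 2 ∣ 2 := by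
    have : (2 : ℤ) = - (P ^ (n + 2) - 1) + 2 ^ Z * ((n + 1) * P ^ n - 2 ^ Z * c) := by
      linear_combination -hc
    nth_rewrite 2 [this]
    exact dvd_add (dvd_neg.2 h1) (h2.mul_right _)
  norm_num at h3

lemma disc_mul_lucas_sq_le {P E : ℤ} {Z q : ℕ} (hq : q.Prime) (h5 : 5 ≤ q) (hZ : 1 ≤ Z)
    (hP : Odd P) (hE : 0 < E) (h : P ^ 2 + E = 2 ^ (Z + 2))
    (hU : lucas P (2 ^ Z) q = 1 ∨ lucas P (2 ^ Z) q = -1 ∨ lucas P (2 ^ Z) q = q) :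
    E * lucas P (2 ^ Z) q ^ 2 ≤ 16 * (q : ℤ) ^ 3 := by
  obtain ⟨n, rfl⟩ : ∃ n, q = n + 3 := ⟨q - 3, by omega⟩
  have hn : Even n := by
    have := hq.odd_of_ne_two (by omega)
    rw [Nat.odd_add] at this
    by_contra hne
    exact absurd (this.1 (Nat.not_even_iff_odd.1 hne)) (by decide)
  have hE' : E < 4 * 2 ^ Z ∧ P ^ 2 < 4 * 2 ^ Z := by
    rw [pow_add] at h
    have : 0 < P ^ 2 := by
      have : P ≠ 0 := by rintro rfl; simp at hP
      positivity
    constructor <;> linarith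
  have hn2 : (2 : ℤ) ≤ n := by
    have : 2 ≤ n := by omega
    exact_mod_cast this
  rcases hU with h1 | h1 | h1 <;> rw [h1]
  · have h2 := two_pow_le_of_lucas_eq_one hZ hP hn h1
    have h3 : 1 ≤ |P| := by
      have : P ≠ 0 := by rintro rfl; simp at hP
      exact Int.one_le_abs this
    have h4 : (|P| + 1) ^ 2 ≤ 4 * P ^ 2 := by
      rw [← sq_abs P]
      nlinarith
    have hpos : (0 : ℤ) < 2 ^ Z := by positivity
    have h5 : (2 : ℤ) ^ Z * 2 ^ Z ≤ 2 ^ Z * (16 * (n + 2) ^ 2) := by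
      calc (2 : ℤ) ^ Z * 2 ^ Z ≤ ((|P| + 1) * (n + 2)) * ((|P| + 1) * (n + 2)) := by gcongr
        _ = (|P| + 1) ^ 2 * (n + 2) ^ 2 := by ring
        _ ≤ (4 * (4 * 2 ^ Z)) * (n + 2) ^ 2 := by
          gcongr
          linarith [hE'.2]
        _ = _ := by ring
    have h6 := le_of_mul_le_mul_left h5 hpos
    push_cast
    nlinarith [hE'.1]
  · have hZ1 : Z = 1 := by
      by_contra hne
      exact lucas_ne_neg_one (by omega) hP hn h1
    subst hZ1
    have h2 : (3 : ℤ) ^ 3 ≤ (n + 3) ^ 3 := by gcongr; linarith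
    push_cast
    linarith [hE'.1]
  · have h2 := Nat.le_of_dvd (by omega) (two_pow_dvd_of_lucas_eq_self hP hn h1)
    have h3 : (2 : ℤ) ^ Z ≤ n + 2 := by exact_mod_cast h2
    have h4 : E ≤ 4 * (n + 3) := by linarith [hE'.1]
    push_cast
    nlinarith [mul_le_mul_of_nonneg_right h4 (sq_nonneg ((n : ℤ) + 3))]

lemma mul_le_of_lucas {P E : ℤ} {Z q : ℕ} (hq : q.Prime) (h5 : 5 ≤ q) (hZ : 1 ≤ Z)
    (hP : Odd P) (hE : 0 < E) (h : P ^ 2 + E = 2 ^ (Z + 2))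
    (hU : lucas P (2 ^ Z) q = 1 ∨ lucas P (2 ^ Z) q = -1 ∨ lucas P (2 ^ Z) q = q) :
    q * Z ≤ 38 := by
  by_contra! hlt
  have hle := disc_mul_lucas_sq_le hq h5 hZ hP hE h hU
  have hid := exists_sq_add_mul_lucas_sq (P := P) (Q := 2 ^ Z) (E := E)
    (by rw [h, pow_add]; ring) q
  set x := 2 * lucas P (2 ^ Z) (q + 1) - P * lucas P (2 ^ Z) q
  have hqo : Odd q := hq.odd_of_ne_two (by omega)
  have hUo : Odd (lucas P (2 ^ Z) q) := by
    rcases hU with h1 | h1 | h1 <;> rw [h1]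
    · decide
    · decide
    · exact_mod_cast hqo
  have hxo : Odd x := (even_two_mul _).sub_odd (hP.mul hUo)
  have hU0 : lucas P (2 ^ Z) q ≠ 0 := by
    intro h0
    rw [h0] at hUo
    exact absurd hUo (by decide)
  have hN : 0 < E * lucas P (2 ^ Z) q ^ 2 := by positivity
  lift E * lucas P (2 ^ Z) q ^ 2 to ℕ using hN.le with N
  have h1 : x.natAbs ^ 2 + N = 2 ^ (q * Z + 2) := by
    zify
    rw [sq_abs, hid, ← pow_mul, pow_add, mul_comm q]
    ring
  have h2 := gap (Int.natAbs_odd.2 hxo) (by exact_mod_cast hN) (by omega) h1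
  have h3 : N ≤ 16 * q ^ 3 := by exact_mod_cast hle
  have h4 : q ^ 3 ≤ (q * Z + 2) ^ 3 := Nat.pow_le_pow_left (by nlinarith) 3
  omega

lemma lucas_classification {P E : ℤ} {Z q : ℕ} (hq : q.Prime) (h5 : 5 ≤ q) (hZ : 1 ≤ Z)
    (hP : Odd P) (hE : 0 < E) (h : P ^ 2 + E = 2 ^ (Z + 2))
    (hdvd : ∀ l : ℕ, l.Prime → (l : ℤ) ∣ lucas P (2 ^ Z) q → (l : ℤ) ∣ E) :
    E = 7 ∧ Z = 1 ∧ (q = 5 ∨ q = 7 ∨ q = 13) ∨ E = 15 ∧ Z = 2 ∧ q = 5 := by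
  have hEo : Odd E := by
    rw [show E = 2 ^ (Z + 2) - P ^ 2 by linarith]
    exact (even_two.pow_of_ne_zero (by omega)).sub_odd hP.pow
  have hU := lucas_eq_one_or_neg_one_or_self hq h5 hEo h hdvd
  have hqZ := mul_le_of_lucas hq h5 hZ hP hE h hU
  have hqo : Odd q := hq.odd_of_ne_two (by omega)
  have hZ8 : Z < 8 := by nlinarith
  have hP2 : P.natAbs ^ 2 < 2 ^ (Z + 2) := by
    zify
    rw [sq_abs]
    linarith
  have hP23 : P.natAbs < 23 := by
    have : (2 : ℕ) ^ (Z + 2) ≤ 2 ^ 9 := Nat.pow_le_pow_right (by norm_num) (by omega)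
    nlinarith
  rw [← lucas_natAbs P _ hqo, lucas_eq_lucasAux] at hU
  obtain ⟨hp1, hcase⟩ := lucas_small_cases q (by nlinarith) Z hZ8 P.natAbs hP23
    ⟨h5, hZ, hqZ, hq, hP2, Nat.odd_iff.1 (Int.natAbs_odd.2 hP), hU⟩
  have hPP : P ^ 2 = 1 := by rw [← Int.natAbs_sq, hp1]; rfl
  rw [hPP] at h
  rcases hcase with ⟨rfl, hq'⟩ | ⟨rfl, hq'⟩
  · left
    exact ⟨by norm_num at h; linarith, rfl, hq'⟩
  · right
    exact ⟨by norm_num at h; linarith, rfl, hq'⟩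

lemma eq_two_of_mul_add_two_eq_two_pow {a m : ℕ} (h : a * (a + 2) = 2 ^ m) : a = 2 := by
  obtain ⟨u, -, hu⟩ := (Nat.dvd_prime_pow Nat.prime_two).1 (Dvd.intro _ h)
  obtain ⟨v, -, hv⟩ := (Nat.dvd_prime_pow Nat.prime_two).1 (Dvd.intro_left _ h)
  rcases u with _ | _ | u
  · rcases v with _ | v
    · omega
    · rw [pow_succ] at hv
      omega
  · simpa using hu
  · rcases v with _ | _ | v
    · simp at hv
    · have := Nat.two_pow_pos (u + 1 + 1)
      omega
    · rw [pow_add] at hu hv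
      omega

lemma eq_one_of_mul_eq_three_pow {a b i : ℕ} (h : a * b = 3 ^ i) (h3 : ¬ 3 ∣ a + b) (hab : a < b) :
    a = 1 := by
  obtain ⟨u, -, hu⟩ := (Nat.dvd_prime_pow Nat.prime_three).1 (Dvd.intro _ h)
  obtain ⟨v, -, hv⟩ := (Nat.dvd_prime_pow Nat.prime_three).1 (Dvd.intro_left _ h)
  rcases u with _ | u
  · simpa using hu
  · rcases v with _ | v
    · have := Nat.pow_pos (n := u + 1) (by norm_num : 0 < 3)
      omega
    · rw [pow_succ] at hu hv
      omega

lemma two_pow_mod_three (z : ℕ) : 2 ^ (2 * z) % 3 = 1 ∧ 2 ^ (2 * z + 1) % 3 = 2 := by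
  have h : 2 ^ (2 * z) % 3 = 1 := by rw [pow_mul, Nat.pow_mod]; simp
  exact ⟨h, by rw [pow_succ]; omega⟩

lemma sq_mod_three (p : ℕ) : p ^ 2 % 3 = 0 ∨ p ^ 2 % 3 = 1 := by
  rw [Nat.pow_mod]
  have := Nat.mod_lt p (by norm_num : 3 > 0)
  interval_cases p % 3 <;> simp

lemma three_pow_mod_eight (i : ℕ) : 3 ^ i % 8 = 1 ∧ Even i ∨ 3 ^ i % 8 = 3 ∧ Odd i := by
  induction i with
  | zero => simp
  | succ i ih =>
    rw [pow_succ]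
    rcases ih with ⟨h, h'⟩ | ⟨h, h'⟩
    · exact Or.inr ⟨by omega, h'.add_one⟩
    · exact Or.inl ⟨by omega, h'.add_one⟩

lemma sq_eq_two_pow_add_three_pow {p Z i : ℕ} (hZ : 1 ≤ Z) (h : p ^ 2 = 2 ^ Z + 3 ^ i) :
    p = 3 ∧ Z = 3 ∧ i = 0 ∨ p = 5 ∧ Z = 4 ∧ i = 2 := by
  rcases Nat.eq_zero_or_pos i with rfl | hi
  · left
    obtain ⟨a, rfl⟩ : ∃ a, p = a + 1 := Nat.exists_eq_succ_of_ne_zero (by rintro rfl; simp at h)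
    have h1 : a * (a + 2) = 2 ^ Z := by linarith [show (a + 1) ^ 2 = a * (a + 2) + 1 by ring]
    have h2 := eq_two_of_mul_add_two_eq_two_pow h1
    subst h2
    have h3 : 2 ^ 3 = 2 ^ Z := by simpa using h1
    exact ⟨rfl, (Nat.pow_right_injective le_rfl h3).symm, rfl⟩
  · right
    obtain ⟨i, rfl⟩ := Nat.exists_eq_succ_of_ne_zero hi.ne'
    have hp := sq_mod_three p
    rcases Nat.even_or_odd' Z with ⟨z, rfl | rfl⟩
    · have hz := (two_pow_mod_three z).1
      have hlt : 2 ^ z < p := by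
        refine lt_of_pow_lt_pow_left₀ 2 (Nat.zero_le _) ?_
        rw [h, ← pow_mul, mul_comm z]
        exact Nat.lt_add_of_pos_right (by positivity)
      obtain ⟨a, ha⟩ := Nat.exists_eq_add_of_lt hlt
      have h1 : (a + 1) * (2 ^ z + p) = 3 ^ (i + 1) := by
        have : (2 ^ z) ^ 2 + (a + 1) * (2 ^ z + p) = p ^ 2 := by rw [ha]; ring
        rw [h, ← pow_mul, mul_comm z] at this
        omega
      have h2 := eq_one_of_mul_eq_three_pow h1 (fun h3 : 3 ∣ a + 1 + (2 ^ z + p) => by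
        rw [show a + 1 + (2 ^ z + p) = 2 * p by rw [ha]; ring] at h3
        have : 3 ∣ p := (Nat.Coprime.dvd_of_dvd_mul_left (by norm_num) h3)
        obtain ⟨c, rfl⟩ := this
        rw [mul_pow, pow_succ 3 i] at h
        omega) (by have := Nat.two_pow_pos z; omega)
      have ha0 : a = 0 := by omega
      subst ha0
      rcases z with _ | z
      · simp at hZ
      rcases three_pow_mod_eight (i + 1) with ⟨-, t, ht⟩ | ⟨hm, -⟩
      · have h3 : 3 ^ (i + 1) = (3 ^ t) ^ 2 := by rw [ht, ← pow_mul]; ring_nf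
        obtain ⟨b, hb⟩ : ∃ b, 3 ^ t = b + 1 := Nat.exists_eq_succ_of_ne_zero (by positivity)
        have h4 : b * (b + 2) = 2 ^ (z + 1 + 1) := by
          rw [h3, hb, ha] at h1
          rw [pow_succ 2 (z + 1)]
          linarith [show (b + 1) ^ 2 = b * (b + 2) + 1 by ring]
        obtain rfl := eq_two_of_mul_add_two_eq_two_pow h4
        have h5 : z + 1 + 1 = 3 := (Nat.pow_right_injective (le_refl 2)
          (by simpa using h4 : 2 ^ 3 = 2 ^ (z + 1 + 1))).symm
        have h6 : t = 1 := Nat.pow_right_injective (by norm_num : 2 ≤ 3) (by simpa using hb)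
        obtain rfl : z = 1 := by omega
        refine ⟨by simpa using ha, rfl, by omega⟩
      · exfalso
        rw [← h1, ha] at hm
        rw [pow_succ] at hm
        rcases z with _ | z
        · norm_num at hm
        · rw [pow_succ] at hm
          omega
    · have hz := (two_pow_mod_three z).2
      rw [pow_succ 3 i] at h
      omega

lemma sq_add_three_pow_eq_two_pow {p Z i : ℕ} (hZ : 1 ≤ Z) (hp0 : Odd p)
    (h : p ^ 2 + 3 ^ i = 2 ^ Z) :
    p = 1 ∧ Z = 1 ∧ i = 0 ∨ p = 1 ∧ Z = 2 ∧ i = 1 := by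
  have hp8 : p ^ 2 % 8 = 1 := by
    rcases hp0 with ⟨m, rfl⟩
    rcases Nat.even_or_odd' m with ⟨c, rfl | rfl⟩ <;> ring_nf <;> omega
  have h8 : Z ≤ 2 := by
    by_contra! hlt
    obtain ⟨z, rfl⟩ := Nat.exists_eq_add_of_le (show 3 ≤ Z from hlt)
    rw [pow_add] at h
    rcases three_pow_mod_eight i with ⟨h3, -⟩ | ⟨h3, -⟩ <;> omega
  have hp1 : p = 1 := by
    have : (2 : ℕ) ^ Z ≤ 2 ^ 2 := Nat.pow_le_pow_right (by norm_num) h8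
    have h3i : 0 < 3 ^ i := by positivity
    have h2 : p < 2 := by nlinarith
    have h3 := hp0.pos
    omega
  subst hp1
  interval_cases Z
  · left
    refine ⟨rfl, rfl, ?_⟩
    exact Nat.pow_right_injective (by norm_num : 2 ≤ 3) (show 3 ^ i = 3 ^ 0 by omega)
  · right
    refine ⟨rfl, rfl, ?_⟩
    exact Nat.pow_right_injective (by norm_num : 2 ≤ 3) (show 3 ^ i = 3 ^ 1 by omega)

lemma lucas_three (P Q : ℤ) : lucas P Q 3 = P ^ 2 - Q := by
  simp [lucas]
  ring

lemma lucas_three_classification {P E : ℤ} {Z : ℕ} (hZ : 1 ≤ Z) (hP : Odd P)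
    (h : P ^ 2 + E = 2 ^ (Z + 2))
    (hdvd : ∀ l : ℕ, l.Prime → (l : ℤ) ∣ lucas P (2 ^ Z) 3 → (l : ℤ) ∣ E) :
    E = 7 ∧ Z = 1 ∨ E = 23 ∧ Z = 3 ∨ E = 15 ∧ Z = 2 ∧ lucas P (2 ^ Z) 3 = -3 ∨
      E = 39 ∧ Z = 4 ∧ lucas P (2 ^ Z) 3 = 9 := by
  rw [lucas_three] at *
  have hUo : Odd (P ^ 2 - 2 ^ Z) := hP.pow.sub_even (even_two.pow_of_ne_zero (by omega))
  have hU0 : (P ^ 2 - 2 ^ Z).natAbs ≠ 0 := by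
    intro h0
    rw [Int.natAbs_eq_zero.1 h0] at hUo
    exact absurd hUo (by decide)
  have hpow := Nat.eq_prime_pow_of_unique_prime_dvd (p := 3) hU0 (fun {l} hl hlU => by
    have hlU' : (l : ℤ) ∣ P ^ 2 - 2 ^ Z := Int.natCast_dvd.2 hlU
    have h1 : (l : ℤ) ∣ 3 * 2 ^ Z := by
      rw [show (3 : ℤ) * 2 ^ Z = (P ^ 2 - 2 ^ Z) + E by rw [pow_add] at h; linarith]
      exact dvd_add hlU' (hdvd l hl hlU')
    have h2 : l ∣ 3 * 2 ^ Z := by exact_mod_cast h1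
    rcases hl.dvd_mul.1 h2 with h3 | h3
    · exact (Nat.prime_dvd_prime_iff_eq hl Nat.prime_three).1 h3
    · have h4 := (Nat.prime_dvd_prime_iff_eq hl Nat.prime_two).1 (hl.dvd_of_dvd_pow h3)
      subst h4
      exact absurd (even_iff_two_dvd.2 hlU') (Int.not_even_iff_odd.2 hUo))
  set i := (P ^ 2 - 2 ^ Z).natAbs.primeFactorsList.length
  have hPs : ((P.natAbs : ℤ)) ^ 2 = P ^ 2 := by simp
  rcases Int.natAbs_eq (P ^ 2 - 2 ^ Z) with hs | hs <;> rw [hpow] at hs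
  · have h1 : P.natAbs ^ 2 = 2 ^ Z + 3 ^ i := by
      zify
      rw [sq_abs]
      push_cast at hs
      linarith
    rcases sq_eq_two_pow_add_three_pow hZ h1 with ⟨hp, hz, hi⟩ | ⟨hp, hz, hi⟩ <;>
      rw [hp] at hPs <;> rw [hz] at h ⊢ <;> rw [← hPs] at h ⊢ <;> norm_num at h ⊢ <;> omega
  · have h1 : P.natAbs ^ 2 + 3 ^ i = 2 ^ Z := by
      zify
      rw [sq_abs]
      push_cast at hs
      linarith
    rcases sq_add_three_pow_eq_two_pow hZ (Int.natAbs_odd.2 hP) h1 with ⟨hp, hz, hi⟩ | ⟨hp, hz, hi⟩ <;>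
      rw [hp] at hPs <;> rw [hz] at h ⊢ <;> rw [← hPs] at h ⊢ <;> norm_num at h ⊢ <;> omega

/-- The quadratic order of discriminant `1 - 8 * e`, generated by a root of `X ^ 2 - X + 2 * e`. -/
abbrev QuadraticOrder (e : ℤ) : Type := QuadraticAlgebra ℤ (-(2 * e)) 1

namespace QuadraticOrder

open QuadraticAlgebra

variable {e : ℤ}

lemma norm_eq (z : QuadraticOrder e) :
    norm z = z.re ^ 2 + z.re * z.im + 2 * e * z.im ^ 2 := by
  rw [norm_def]
  ring

lemma trace_sq_add (z : QuadraticOrder e) :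
    (2 * z.re + z.im) ^ 2 + (8 * e - 1) * z.im ^ 2 = 4 * norm z := by
  rw [norm_eq]
  ring

lemma im_pow (z : QuadraticOrder e) (n : ℕ) :
    (z ^ n).im = lucas (2 * z.re + z.im) (norm z) n * z.im := by
  induction n using Nat.twoStepInduction with
  | zero => simp [lucas]
  | one => simp [lucas]
  | more n h0 h1 =>
    have h : z ^ (n + 2) = (2 * z.re + z.im) • z ^ (n + 1) - norm z • z ^ n := by
      have h2 : z ^ 2 = (2 * z.re + z.im) • z - norm z • 1 := by
        rw [norm_eq, sq]
        ext <;> simp [-zsmul_eq_mul, -zsmul_one] <;> ring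
      rw [pow_add, h2, mul_sub, mul_smul_comm, mul_smul_comm, mul_one, pow_succ]
    rw [h, im_sub, im_smul, im_smul, h0, h1, lucas_add_two, smul_eq_mul, smul_eq_mul]
    ring

lemma exists_eq_mul_of_dvd_im_star_mul {α β : QuadraticOrder e} {a b : ℕ} (hα : norm α = 2 ^ a)
    (hαo : Odd α.im) (hβ : norm β = 2 ^ b) (hab : a ≤ b)
    (h : 2 ^ a ∣ (star α * β).im) : ∃ γ, β = α * γ ∧ norm γ = 2 ^ (b - a) := by
  have hre : (2 : ℤ) ^ a ∣ (star α * β).re := by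
    have hco : IsCoprime ((2 : ℤ) ^ a) α.im :=
      ((Int.prime_two.coprime_iff_not_dvd).2 (fun h2 =>
        Int.not_even_iff_odd.2 hαo (even_iff_two_dvd.2 h2))).pow_left
    refine hco.dvd_of_dvd_mul_left ?_
    have h1 : α.im * (star α * β).re =
        β.im * 2 ^ a - (α.re + α.im) * (star α * β).im := by
      rw [← hα, norm_eq]
      simp
      ring
    rw [h1]
    exact dvd_sub (Dvd.intro_left _ rfl) (h.mul_left _)
  obtain ⟨r, hr⟩ := hre
  obtain ⟨i, hi⟩ := h
  have h2 : (2 : ℤ) ^ a ≠ 0 := by positivity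
  have hmul : star α * β = (2 : ℤ) ^ a • (⟨r, i⟩ : QuadraticOrder e) := by
    ext
    · simp [hr]
    · simp [hi]
  have hβ' : β = α * ⟨r, i⟩ := by
    have h3 : (2 : ℤ) ^ a • β = (2 : ℤ) ^ a • (α * ⟨r, i⟩) := by
      rw [← mul_smul_comm, ← hmul, ← mul_assoc, ← algebraMap_norm_eq_mul_star, hα,
        Algebra.smul_def]
    ext
    · simpa [h2, -zsmul_eq_mul] using congrArg QuadraticAlgebra.re h3
    · simpa [h2, -zsmul_eq_mul] using congrArg QuadraticAlgebra.im h3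
  refine ⟨⟨r, i⟩, hβ', ?_⟩
  rw [hβ', map_mul, hα] at hβ
  refine mul_left_cancel₀ h2 ?_
  rw [hβ, ← pow_add, Nat.add_sub_cancel' hab]

lemma exists_eq_mul {α β : QuadraticOrder e} {a b : ℕ} (hα : norm α = 2 ^ a)
    (hαo : Odd α.im) (hβ : norm β = 2 ^ b) (hβo : Odd β.im) (hab : a ≤ b) :
    ∃ γ, (β = α * γ ∨ star β = α * γ) ∧ norm γ = 2 ^ (b - a) := by
  set i := (star α * β).im with hi
  set j := (star α * star β).im with hj
  have hsub : i - j = α.im * β.im + 2 * (α.re * β.im) := by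
    simp [hi, hj]
    ring
  have hmul : i * j = 2 ^ b * α.im ^ 2 - 2 ^ a * β.im ^ 2 := by
    rw [← hα, ← hβ, norm_eq, norm_eq]
    simp [hi, hj]
    ring
  have hdvd : 2 ^ a ∣ i * j := by
    rw [hmul]
    exact dvd_sub ((pow_dvd_pow 2 hab).mul_right _) (Dvd.intro _ rfl)
  have hodd : Odd (i - j) := by
    rw [hsub]
    exact (hαo.mul hβo).add_even (even_two_mul _)
  have hco : ∀ c : ℤ, Odd c → IsCoprime ((2 : ℤ) ^ a) c := fun c hc =>
    ((Int.prime_two.coprime_iff_not_dvd).2 (fun h2 =>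
        Int.not_even_iff_odd.2 hc (even_iff_two_dvd.2 h2))).pow_left
  rcases Int.even_or_odd j with hje | hjo
  · have hio : Odd i := by
      rw [show i = (i - j) + j by ring]
      exact hodd.add_even hje
    obtain ⟨γ, h1, h2⟩ := exists_eq_mul_of_dvd_im_star_mul hα hαo ((norm_star β).trans hβ) hab
      ((hco i hio).dvd_of_dvd_mul_left hdvd)
    exact ⟨γ, Or.inr h1, h2⟩
  · obtain ⟨γ, h1, h2⟩ := exists_eq_mul_of_dvd_im_star_mul hα hαo hβ hab
      ((hco j hjo).dvd_of_dvd_mul_right hdvd)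
    exact ⟨γ, Or.inl h1, h2⟩

lemma eq_one_or_eq_neg_one (he : 1 ≤ e) {γ : QuadraticOrder e} (h : norm γ = 1) :
    γ = 1 ∨ γ = -1 := by
  have h1 := trace_sq_add γ
  rw [h] at h1
  have him : γ.im = 0 := by
    by_contra hne
    have : 0 < γ.im ^ 2 := by positivity
    nlinarith [sq_nonneg (2 * γ.re + γ.im)]
  rw [him] at h1
  have hre : γ.re ^ 2 = 1 := by linarith
  rcases sq_eq_one_iff.1 hre with h2 | h2
  · left; ext <;> simp [h2, him]
  · right; ext <;> simp [h2, him]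

lemma odd_im_of_mul {α γ : QuadraticOrder e} (h : Odd (α * γ).im) (hγ : Even (norm γ)) :
    Odd γ.im := by
  by_contra hne
  rw [Int.not_odd_iff_even] at hne
  have hre : Even γ.re := by
    rw [norm_eq] at hγ
    simpa [hne, Int.even_add, Int.even_mul, Int.even_pow, parity_simps] using hγ
  rw [im_mul] at h
  simp [hne, hre, ← Int.not_even_iff_odd, parity_simps] at h

lemma exists_eq_pow (he : 1 ≤ e) {α : QuadraticOrder e} {Z : ℕ} (hZ : 1 ≤ Z)
    (hα : norm α = 2 ^ Z) (hαo : Odd α.im)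
    (hmin : ∀ (β : QuadraticOrder e) (b : ℕ), 1 ≤ b → norm β = 2 ^ b → Odd β.im → Z ≤ b)
    (b : ℕ) (hb : 1 ≤ b) (β : QuadraticOrder e) (hβ : norm β = 2 ^ b) (hβo : Odd β.im) :
    ∃ t, 1 ≤ t ∧ b = t * Z ∧
      ((β = α ^ t ∨ β = -α ^ t) ∨ (star β = α ^ t ∨ star β = -α ^ t)) := by
  induction b using Nat.strong_induction_on generalizing β with
  | _ b ih =>
    have hle := hmin β b hb hβ hβo
    obtain ⟨γ, hγ, hn⟩ := exists_eq_mul hα hαo hβ hβo hle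
    have hαγ : Odd (α * γ).im := by
      rcases hγ with h | h <;> rw [← h]
      · exact hβo
      · simpa using hβo
    suffices h : ∃ t, 1 ≤ t ∧ b = t * Z ∧ (α * γ = α ^ t ∨ α * γ = -α ^ t) by
      obtain ⟨t, ht, hbt, h⟩ := h
      refine ⟨t, ht, hbt, ?_⟩
      rcases hγ with h' | h' <;> rw [← h'] at h
      · exact Or.inl h
      · exact Or.inr h
    rcases hle.eq_or_lt with rfl | hlt
    · rw [Nat.sub_self, pow_zero] at hn
      refine ⟨1, le_rfl, (one_mul _).symm, ?_⟩
      rcases eq_one_or_eq_neg_one he hn with h | h <;> simp [h]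
    · have hγo : Odd γ.im := odd_im_of_mul hαγ (by
        rw [hn]; exact even_two.pow_of_ne_zero (by omega))
      obtain ⟨s, hs, hbs, h⟩ := ih (b - Z) (by omega) (by omega) γ hn hγo
      rcases h with h | h
      · refine ⟨s + 1, by omega, by rw [add_mul, ← hbs]; omega, ?_⟩
        rcases h with h | h <;> rw [h, pow_succ'] <;> simp
      · exfalso
        obtain ⟨r, rfl⟩ := Nat.exists_eq_add_of_le' hs
        have h1 : ∃ δ, γ = star α * δ := by
          rcases h with h | h
          · exact ⟨star α ^ r, by rw [← star_star γ, h, star_pow, pow_succ']⟩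
          · exact ⟨-star α ^ r, by rw [← star_star γ, h, star_neg, star_pow, pow_succ']; ring⟩
        obtain ⟨δ, rfl⟩ := h1
        rw [← mul_assoc, ← algebraMap_norm_eq_mul_star, hα, ← Algebra.smul_def, im_smul,
          smul_eq_mul] at hαγ
        exact Int.not_even_iff_odd.2 hαγ
          ((even_two.pow_of_ne_zero (by omega)).mul_right _)

end QuadraticOrder

/-- A solution of `x ^ 2 + D ^ (2 * s + 1) = 2 ^ (n + 2)` comes from a proper prime power in the
quadratic order of discriminant `-D`. -/
def IsPrimePowerSolution (D s n : ℕ) : Prop :=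
  ∃ (q Z : ℕ) (P Y : ℤ), q.Prime ∧ 1 ≤ Z ∧ n = q * Z ∧ Odd P ∧ P ^ 2 + D * Y ^ 2 = 2 ^ (Z + 2) ∧
    (lucas P (2 ^ Z) q * Y).natAbs = D ^ s

namespace QuadraticOrder

open QuadraticAlgebra

lemma exists_norm_eq_two_pow {e : ℤ} {D x s n : ℕ} (hD : (D : ℤ) = 8 * e - 1)
    (h : x ^ 2 + D ^ (2 * s + 1) = 2 ^ (n + 2)) :
    ∃ β : QuadraticOrder e, norm β = 2 ^ n ∧ β.im = D ^ s := by
  have hDo : Odd D := by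
    rw [Nat.odd_iff]
    omega
  have hxo : Odd x := by
    have h1 : Even (x ^ 2 + D ^ (2 * s + 1)) := h ▸ even_two.pow_of_ne_zero (by omega)
    exact Nat.Odd.of_mul_left (sq x ▸ (Nat.even_add'.1 h1).2 hDo.pow)
  have hev : Even ((x : ℤ) - (D : ℤ) ^ s) := (hxo.natCast).sub_odd hDo.natCast.pow
  obtain ⟨r, hr⟩ := even_iff_two_dvd.1 hev
  refine ⟨⟨r, D ^ s⟩, ?_, rfl⟩
  have h1 := trace_sq_add (⟨r, D ^ s⟩ : QuadraticOrder e)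
  simp only [← hr, sub_add_cancel, ← hD] at h1
  have h2 : (x : ℤ) ^ 2 + (D : ℤ) ^ (2 * s + 1) = 2 ^ (n + 2) := by exact_mod_cast h
  have h3 : (4 : ℤ) * norm (⟨r, D ^ s⟩ : QuadraticOrder e) = 4 * 2 ^ n := by
    rw [← h1, show (4 : ℤ) * 2 ^ n = 2 ^ (n + 2) by ring, ← h2]
    ring
  linarith

lemma isPrimePowerSolution_of_pow {e : ℤ} {D s n t Z : ℕ} (hD : (D : ℤ) = 8 * e - 1)
    {α : QuadraticOrder e} (hZ : 1 ≤ Z) (hα : norm α = 2 ^ Z) (ht : 1 ≤ t) (ht1 : t ≠ 1)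
    (hn : n = t * Z) (h : (α ^ t).im.natAbs = D ^ s) : IsPrimePowerSolution D s n := by
  have hDo : Odd D := by
    rw [Nat.odd_iff]
    omega
  obtain ⟨q, hq, r, rfl⟩ := Nat.exists_prime_and_dvd ht1
  have hr : 1 ≤ r := Nat.pos_of_ne_zero (by rintro rfl; simp at ht)
  have hnr : norm (α ^ r) = 2 ^ (r * Z) := by rw [map_pow, hα, ← pow_mul, mul_comm]
  have him : ((α ^ r) ^ q).im.natAbs = D ^ s := by rw [← pow_mul, mul_comm r, h]
  rw [im_pow, hnr] at him
  have hodd : Odd (α ^ r).im := by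
    have h1 : Odd (D ^ s) := hDo.pow
    rw [← him, Int.natAbs_odd] at h1
    exact Int.Odd.of_mul_right h1
  refine ⟨q, r * Z, 2 * (α ^ r).re + (α ^ r).im, (α ^ r).im, hq, Nat.mul_pos hr hZ, by rw [hn]; ring,
    (even_two_mul _).add_odd hodd, ?_, him⟩
  rw [hD, trace_sq_add, hnr]
  ring

end QuadraticOrder

open QuadraticOrder in
lemma isPrimePowerSolution_or_eq {D x s n x' s' n' : ℕ} (hD : 8 ∣ D + 1)
    (hn : 1 ≤ n) (hn' : 1 ≤ n') (h : x ^ 2 + D ^ (2 * s + 1) = 2 ^ (n + 2))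
    (h' : x' ^ 2 + D ^ (2 * s' + 1) = 2 ^ (n' + 2)) :
    IsPrimePowerSolution D s n ∨ IsPrimePowerSolution D s' n' ∨ x = x' ∧ s = s' ∧ n = n' := by
  obtain ⟨e, he⟩ : ∃ e : ℕ, D + 1 = 8 * e := hD
  have hDe : (D : ℤ) = 8 * (e : ℤ) - 1 := by omega
  have he1 : (1 : ℤ) ≤ e := by omega
  have hDo : Odd D := by
    rw [Nat.odd_iff]
    omega
  have hDoZ : ∀ i, Odd ((D : ℤ) ^ i) := fun i => hDo.natCast.pow
  obtain ⟨β, hβ, hβi⟩ := exists_norm_eq_two_pow hDe h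
  obtain ⟨β', hβ', hβi'⟩ := exists_norm_eq_two_pow hDe h'
  classical
  have hex : ∃ Z : ℕ, 1 ≤ Z ∧ ∃ α : QuadraticOrder e,
      QuadraticAlgebra.norm α = 2 ^ Z ∧ Odd α.im := ⟨n, hn, β, hβ, hβi ▸ hDoZ s⟩
  obtain ⟨hZ, α, hα, hαo⟩ := Nat.find_spec hex
  have hpow := exists_eq_pow he1 hZ hα hαo
    (fun β b hb h1 h2 => Nat.find_min' hex ⟨hb, β, h1, h2⟩)
  generalize Nat.find hex = Z at hZ hα hpow
  have key : ∀ (s n : ℕ) (β : QuadraticOrder e), 1 ≤ n → QuadraticAlgebra.norm β = 2 ^ n →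
      β.im = D ^ s → ∃ t, 1 ≤ t ∧ n = t * Z ∧ (α ^ t).im.natAbs = D ^ s := by
    intro s n β hn hβ hβi
    obtain ⟨t, ht, hnt, hor⟩ := hpow n hn β hβ (hβi ▸ hDoZ s)
    refine ⟨t, ht, hnt, ?_⟩
    have h1 : β.im.natAbs = D ^ s := by rw [hβi, Int.natAbs_pow, Int.natAbs_natCast]
    rw [← h1]
    rcases hor with (h2 | h2) | (h2 | h2)
    · rw [h2]
    · rw [h2, QuadraticAlgebra.im_neg, Int.natAbs_neg]
    · rw [← h2, QuadraticAlgebra.im_star, Int.natAbs_neg]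
    · rw [← star_star β, h2, QuadraticAlgebra.im_star, QuadraticAlgebra.im_neg, neg_neg]
  obtain ⟨t, ht, hnt, him⟩ := key s n β hn hβ hβi
  obtain ⟨t', ht', hnt', him'⟩ := key s' n' β' hn' hβ' hβi'
  by_cases h1 : t = 1
  · by_cases h1' : t' = 1
    · refine Or.inr (Or.inr ?_)
      subst h1 h1'
      have hnn : n = n' := hnt.trans hnt'.symm
      have hss : s = s' := Nat.pow_right_injective (show 2 ≤ D by omega) (him.symm.trans him')
      subst hnn hss
      refine ⟨?_, rfl, rfl⟩
      exact Nat.pow_left_injective two_ne_zero (by simpa using h.trans h'.symm)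
    · exact Or.inr (Or.inl (isPrimePowerSolution_of_pow hDe hZ hα ht' h1' hnt' him'))
  · exact Or.inl (isPrimePowerSolution_of_pow hDe hZ hα ht h1 hnt him)

lemma exists_odd_mul_eq_pow_add_one {D : ℤ} (hD : Odd D) (s : ℕ) :
    ∃ c, Odd c ∧ D ^ (2 * s + 1) + 1 = (D + 1) * c := by
  induction s with
  | zero => exact ⟨1, odd_one, by ring⟩
  | succ s ih =>
    obtain ⟨c, hc, h⟩ := ih
    refine ⟨D ^ 2 * c - D + 1, ((hD.pow.mul hc).sub_odd hD).add_one, ?_⟩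
    rw [show 2 * (s + 1) + 1 = 2 * s + 1 + 2 by ring, pow_add]
    linear_combination D ^ 2 * h

lemma eq_zero_of_pow_add_one_eq_two_pow {D s k : ℕ} (hD : Odd D) (hD1 : 1 < D)
    (h : D ^ (2 * s + 1) + 1 = 2 ^ k) : s = 0 := by
  obtain ⟨c, hc, hcD⟩ := exists_odd_mul_eq_pow_add_one (hD.natCast (R := ℤ)) s
  have hpos : 0 < c := by
    refine pos_of_mul_pos_right (a := (D : ℤ) + 1) ?_ (by positivity)
    rw [← hcD]
    positivity
  lift c to ℕ using hpos.le
  have h1 : D ^ (2 * s + 1) + 1 = (D + 1) * c := by exact_mod_cast hcD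
  have h2 : c ∣ 2 ^ k := by
    rw [← h, h1]
    exact Dvd.intro_left _ rfl
  have h3 : c = 1 := by
    have hco : Nat.Coprime c (2 ^ k) :=
      (Nat.coprime_two_right.2 (by exact_mod_cast hc)).pow_right k
    exact hco.eq_one_of_dvd h2
  rw [h3, mul_one] at h1
  have h4 : D ^ (2 * s + 1) = D ^ 1 := by rw [pow_one]; omega
  have := Nat.pow_right_injective hD1 h4
  omega

lemma sq_eq_one_of_mul_sq_eq {D : ℕ} {Y E : ℤ} (hD : 7 ≤ D) (h : D * Y ^ 2 = E) (hE : Odd E)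
    (hE39 : E ≤ 39) : Y ^ 2 = 1 := by
  have hYo : Odd Y := by
    rw [← h] at hE
    exact Int.Odd.of_mul_left (sq Y ▸ Int.Odd.of_mul_right hE)
  have hD' : (7 : ℤ) ≤ D := by exact_mod_cast hD
  have h2 : Y ^ 2 < 9 := by nlinarith [sq_nonneg Y]
  have h3 : -3 < Y := by nlinarith
  have h4 : Y < 3 := by nlinarith
  interval_cases Y <;> first | rfl | exact absurd hYo (by decide)

/-- The pairs `(D, n)` for which `x ^ 2 + D ^ m = 2 ^ (n + 2)` has a solution that comes from a
proper prime power. -/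
def IsExceptional (D n : ℕ) : Prop :=
  D = 7 ∧ (n = 2 ∨ n = 3 ∨ n = 5 ∨ n = 7 ∨ n = 13) ∨ D = 23 ∧ n = 9 ∨
    ∃ r, 3 < r ∧ D = 2 ^ r - 1 ∧ n = 2 * r - 4

lemma IsPrimePowerSolution.isExceptional {D s n : ℕ} (hD : 8 ∣ D + 1)
    (h : IsPrimePowerSolution D s n) : IsExceptional D n := by
  obtain ⟨q, Z, P, Y, hq, hZ, rfl, hP, hE, hU⟩ := h
  have hD7 : 7 ≤ D := by omega
  have hDo : Odd D := by
    rw [Nat.odd_iff]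
    omega
  have hdvd : ∀ l : ℕ, l.Prime → (l : ℤ) ∣ lucas P (2 ^ Z) q → (l : ℤ) ∣ D * Y ^ 2 := by
    intro l hl h
    have h1 : l ∣ D ^ s := hU ▸ Int.natCast_dvd.1 (h.mul_right Y)
    exact (Int.natCast_dvd_natCast.2 (hl.dvd_of_dvd_pow h1)).mul_right _
  have hsq : ∀ E : ℤ, D * Y ^ 2 = E → Odd E → E ≤ 39 →
      (D : ℤ) = E ∧ (lucas P (2 ^ Z) q).natAbs = D ^ s := by
    intro E h1 h2 h3
    have hY := sq_eq_one_of_mul_sq_eq hD7 h1 h2 h3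
    refine ⟨by rw [← h1, hY, mul_one], ?_⟩
    rw [Int.natAbs_mul] at hU
    rcases sq_eq_one_iff.1 hY with rfl | rfl <;> simpa using hU
  have hYne : Y ≠ 0 := by
    rintro rfl
    rw [mul_zero, Int.natAbs_zero] at hU
    exact absurd hU.symm (by positivity)
  by_cases hq2 : q = 2
  · subst hq2
    have hl2 : lucas P (2 ^ Z) 2 = P := by simp [lucas]
    rw [hl2] at hU hdvd
    have hEo : Odd ((D : ℤ) * Y ^ 2) := by
      rw [show (D : ℤ) * Y ^ 2 = 2 ^ (Z + 2) - P ^ 2 by linarith]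
      exact (even_two.pow_of_ne_zero (by omega)).sub_odd hP.pow
    have hP1 : P.natAbs = 1 := by
      by_contra hne
      obtain ⟨l, hl, hlP⟩ := Nat.exists_prime_and_dvd hne
      have hlP' : (l : ℤ) ∣ P := Int.natCast_dvd.2 hlP
      exact not_dvd_of_sq_add_eq_two_pow hEo hE hl (hdvd l hl hlP') hlP'
    rw [Int.natAbs_mul, hP1, one_mul] at hU
    have h1 : D ^ (2 * s + 1) + 1 = 2 ^ (Z + 2) := by
      have hY : Y ^ 2 = ((D : ℤ) ^ s) ^ 2 := by
        rw [← Int.natAbs_sq, hU]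
        push_cast
        rfl
      have hPP : P ^ 2 = 1 := by
        rw [← Int.natAbs_sq, hP1]
        rfl
      rw [hY, hPP] at hE
      zify
      rw [← hE]
      ring
    obtain rfl := eq_zero_of_pow_add_one_eq_two_pow hDo (by omega) h1
    rw [mul_zero, zero_add, pow_one] at h1
    rcases hZ.eq_or_lt with rfl | hlt
    · left
      refine ⟨by norm_num at h1; omega, by simp⟩
    · exact Or.inr (Or.inr ⟨Z + 2, by omega, by omega, by omega⟩)
  by_cases hq3 : q = 3
  · subst hq3
    rcases lucas_three_classification hZ hP hE hdvd with
      ⟨h1, h2⟩ | ⟨h1, h2⟩ | ⟨h1, h2, h3⟩ | ⟨h1, h2, h3⟩ <;>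
    obtain ⟨hDE, hl⟩ := hsq _ h1 (by decide) (by norm_num)
    · left
      exact ⟨by exact_mod_cast hDE, by omega⟩
    · right; left
      exact ⟨by exact_mod_cast hDE, by omega⟩
    · exfalso
      obtain rfl : D = 15 := by exact_mod_cast hDE
      rw [h3] at hl
      rcases s with _ | s
      · simp at hl
      · rw [pow_succ] at hl
        omega
    · exfalso
      obtain rfl : D = 39 := by exact_mod_cast hDE
      rw [h3] at hl
      rcases s with _ | s
      · simp at hl
      · rw [pow_succ] at hl
        omega
  have h5 : 5 ≤ q := by
    have := hq.two_le
    by_contra! hlt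
    interval_cases q
    · exact hq2 rfl
    · exact hq3 rfl
    · exact absurd hq (by norm_num)
  have hEpos : 0 < (D : ℤ) * Y ^ 2 := by positivity
  rcases lucas_classification hq h5 hZ hP hEpos hE hdvd with ⟨h1, rfl, h2⟩ | ⟨h1, rfl, rfl⟩
  · obtain ⟨hDE, -⟩ := hsq _ h1 (by decide) (by norm_num)
    left
    exact ⟨by exact_mod_cast hDE, by omega⟩
  · exfalso
    obtain ⟨hDE, hl⟩ := hsq _ h1 (by decide) (by norm_num)
    obtain rfl : D = 15 := by exact_mod_cast hDE
    have hPP : P ^ 2 = 1 := by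
      rw [h1] at hE
      linarith [show (2 : ℤ) ^ (2 + 2) = 16 by norm_num]
    have hl5 : lucas P (2 ^ 2) 5 = 5 := by
      rcases sq_eq_one_iff.1 hPP with rfl | rfl <;> simp [lucas]
    rw [hl5] at hl
    rcases s with _ | s
    · simp at hl
    · rw [pow_succ] at hl
      omega

lemma sq_mod_eight_of_odd {a : ℕ} (ha : Odd a) : a ^ 2 % 8 = 1 := by
  rw [Nat.pow_mod]
  have h1 := Nat.odd_iff.1 ha
  have h2 : a % 8 < 8 := Nat.mod_lt _ (by norm_num)
  have h3 : a % 8 % 2 = 1 := by omega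
  generalize a % 8 = b at h2 h3
  interval_cases b <;> simp_all

lemma eight_dvd_and_odd_of_solution {D x m n : ℕ} (hD : Odd D) (hn : 0 < n)
    (h : x ^ 2 + D ^ m = 2 ^ (n + 2)) : 8 ∣ D + 1 ∧ ∃ s, m = 2 * s + 1 := by
  have h8 : 8 ∣ x ^ 2 + D ^ m := h ▸ pow_dvd_pow 2 (show 3 ≤ n + 2 by omega)
  have hx : Odd x := by
    have h1 : Even (x ^ 2 + D ^ m) := even_iff_two_dvd.2 ((by norm_num : 2 ∣ 8).trans h8)
    exact Nat.Odd.of_mul_left (sq x ▸ (Nat.even_add'.1 h1).2 hD.pow)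
  have hx8 := sq_mod_eight_of_odd hx
  rcases Nat.even_or_odd' m with ⟨s, rfl | rfl⟩
  · have h1 := sq_mod_eight_of_odd (hD.pow (n := s))
    rw [← pow_mul, mul_comm] at h1
    omega
  · have h1 := sq_mod_eight_of_odd (hD.pow (n := s))
    rw [← pow_mul, mul_comm] at h1
    have h2 : D ^ (2 * s + 1) % 8 = D % 8 := by rw [pow_succ, Nat.mul_mod, h1]; simp
    exact ⟨by omega, s, rfl⟩

lemma isExceptional_or_eq {D x m n x' m' n' : ℕ} (hD : Odd D) (hn : 0 < n) (hn' : 0 < n')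
    (h : x ^ 2 + D ^ m = 2 ^ (n + 2)) (h' : x' ^ 2 + D ^ m' = 2 ^ (n' + 2)) :
    IsExceptional D n ∨ IsExceptional D n' ∨ x = x' ∧ m = m' ∧ n = n' := by
  obtain ⟨h8, s, rfl⟩ := eight_dvd_and_odd_of_solution hD hn h
  obtain ⟨-, s', rfl⟩ := eight_dvd_and_odd_of_solution hD hn' h'
  rcases isPrimePowerSolution_or_eq h8 hn hn' h h' with h1 | h1 | ⟨h1, h2, h3⟩
  · exact Or.inl (h1.isExceptional h8)
  · exact Or.inr (Or.inl (h1.isExceptional h8))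
  · exact Or.inr (Or.inr ⟨h1, by rw [h2], h3⟩)

lemma two_pow_sub_one_ne_of_three_lt {r : ℕ} (hr : 3 < r) : 7 ≠ 2 ^ r - 1 ∧ 23 ≠ 2 ^ r - 1 := by
  obtain ⟨t, rfl⟩ := Nat.exists_eq_add_of_lt hr
  rw [show 3 + t + 1 = t + 4 by ring, pow_add]
  have := Nat.two_pow_pos t
  omega

lemma isExceptional_seven_iff {n : ℕ} :
    IsExceptional 7 n ↔ n = 2 ∨ n = 3 ∨ n = 5 ∨ n = 7 ∨ n = 13 := by
  constructor
  · rintro (⟨-, h⟩ | ⟨h, -⟩ | ⟨r, hr, h, -⟩)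
    · exact h
    · exact absurd h (by norm_num)
    · exact absurd h (two_pow_sub_one_ne_of_three_lt hr).1
  · exact fun h => Or.inl ⟨rfl, h⟩

lemma isExceptional_twentythree_iff {n : ℕ} : IsExceptional 23 n ↔ n = 9 := by
  constructor
  · rintro (⟨h, -⟩ | ⟨-, h⟩ | ⟨r, hr, h, -⟩)
    · exact absurd h (by norm_num)
    · exact h
    · exact absurd h (two_pow_sub_one_ne_of_three_lt hr).2
  · exact fun h => Or.inr (Or.inl ⟨rfl, h⟩)

lemma isExceptional_two_pow_sub_one_iff {r n : ℕ} (hr : 3 < r) :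
    IsExceptional (2 ^ r - 1) n ↔ n = 2 * r - 4 := by
  constructor
  · rintro (⟨h, -⟩ | ⟨h, -⟩ | ⟨r', -, h, hn⟩)
    · exact absurd h.symm (two_pow_sub_one_ne_of_three_lt hr).1
    · exact absurd h.symm (two_pow_sub_one_ne_of_three_lt hr).2
    · have h1 := Nat.two_pow_pos r
      have h2 := Nat.two_pow_pos r'
      have h3 : r = r' := Nat.pow_right_injective le_rfl (show 2 ^ r = 2 ^ r' by omega)
      rw [hn, h3]
  · exact fun h => Or.inr (Or.inr ⟨r, hr, rfl, h⟩)

lemma lt_and_lt_of_sq_add_pow_eq {x m D N a b : ℕ} (h : x ^ 2 + D ^ m = N) (ha : N ≤ a ^ 2)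
    (hD : 1 < D) (hb : N ≤ D ^ b) (hx : 0 < x) : x < a ∧ m < b := by
  constructor
  · refine lt_of_pow_lt_pow_left₀ 2 (Nat.zero_le _) ?_
    have : 0 < D ^ m := by positivity
    omega
  · refine (Nat.pow_lt_pow_iff_right hD).1 ?_
    have : 0 < x ^ 2 := by positivity
    omega

lemma solutions_seven {x m n : ℕ} (hx : 0 < x) (hn : 0 < n)
    (h : x ^ 2 + 7 ^ m = 2 ^ (n + 2)) :
    x = 1 ∧ m = 1 ∧ n = 1 ∨ x = 3 ∧ m = 1 ∧ n = 2 ∨ x = 5 ∧ m = 1 ∧ n = 3 ∨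
      x = 11 ∧ m = 1 ∧ n = 5 ∨ x = 13 ∧ m = 3 ∧ n = 7 ∨ x = 181 ∧ m = 1 ∧ n = 13 := by
  rcases isExceptional_or_eq (by decide) hn one_pos h (by norm_num : 1 ^ 2 + 7 ^ 1 = 2 ^ (1 + 2))
    with h1 | h1 | h1
  · rw [isExceptional_seven_iff] at h1
    have hfin : ∀ n ∈ [2, 3, 5, 7, 13], ∀ x ∈ range 182, ∀ m ∈ range 6,
        x ^ 2 + 7 ^ m = 2 ^ (n + 2) ∧ 0 < m → (x, m, n) ∈ [(3, 1, 2), (5, 1, 3), (11, 1, 5), (13, 3, 7), (181, 1, 13)] := by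
      decide +kernel
    obtain ⟨-, s, hs⟩ := eight_dvd_and_odd_of_solution (by decide) hn h
    have hle : 2 ^ (n + 2) ≤ 2 ^ 15 := Nat.pow_le_pow_right (by norm_num) (by omega)
    have hb := lt_and_lt_of_sq_add_pow_eq (a := 182) (b := 6) h (hle.trans (by norm_num))
      (by norm_num) (hle.trans (by norm_num)) hx
    have h2 := hfin n (by simpa using h1) x (mem_range.2 hb.1) m (mem_range.2 hb.2) ⟨h, by omega⟩
    simp only [List.mem_cons, Prod.mk.injEq, List.not_mem_nil, or_false] at h2
    exact Or.inr h2
  · rw [isExceptional_seven_iff] at h1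
    norm_num at h1
  · exact Or.inl h1

lemma solutions_twentythree {x m n : ℕ} (hx : 0 < x) (hn : 0 < n)
    (h : x ^ 2 + 23 ^ m = 2 ^ (n + 2)) :
    x = 3 ∧ m = 1 ∧ n = 3 ∨ x = 45 ∧ m = 1 ∧ n = 9 := by
  rcases isExceptional_or_eq (by decide) hn three_pos h
    (by norm_num : 3 ^ 2 + 23 ^ 1 = 2 ^ (3 + 2)) with h1 | h1 | h1
  · rw [isExceptional_twentythree_iff] at h1
    subst h1
    have hfin : ∀ x < 46, ∀ m < 3, x ^ 2 + 23 ^ m = 2 ^ (9 + 2) → 0 < m → x = 45 ∧ m = 1 := by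
      decide +kernel
    obtain ⟨-, s, hs⟩ := eight_dvd_and_odd_of_solution (by decide) hn h
    have hb := lt_and_lt_of_sq_add_pow_eq (a := 46) (b := 3) h (by norm_num)
      (by norm_num) (by norm_num) hx
    obtain ⟨h2, h3⟩ := hfin x hb.1 m hb.2 h (by omega)
    exact Or.inr ⟨h2, h3, rfl⟩
  · rw [isExceptional_twentythree_iff] at h1
    omega
  · exact Or.inl h1

lemma sq_add_two_pow_sub_one {r : ℕ} (hr : 2 ≤ r) :
    (2 ^ (r - 1) - 1) ^ 2 + (2 ^ r - 1) = 2 ^ (2 * r - 4 + 2) := by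
  obtain ⟨t, rfl⟩ := Nat.exists_eq_add_of_le' hr
  have h1 := Nat.two_pow_pos (t + 1)
  obtain ⟨c, hc⟩ := Nat.exists_eq_succ_of_ne_zero h1.ne'
  rw [show 2 * (t + 2) - 4 + 2 = (t + 1) + (t + 1) by omega, show t + 2 - 1 = t + 1 by omega,
    show t + 2 = t + 1 + 1 by ring, pow_succ 2 (t + 1), pow_add 2 (t + 1), hc]
  rw [show (c + 1) * 2 - 1 = 2 * c + 1 by omega, Nat.succ_eq_add_one, Nat.add_sub_cancel]
  ring

lemma solutions_two_pow_sub_one {r x m n : ℕ} (hr : 3 < r) (hn : 0 < n)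
    (h : x ^ 2 + (2 ^ r - 1) ^ m = 2 ^ (n + 2)) :
    x = 1 ∧ m = 1 ∧ n = r - 2 ∨ x = 2 ^ (r - 1) - 1 ∧ m = 1 ∧ n = 2 * r - 4 := by
  have hr0 := Nat.two_pow_pos r
  have hDo : Odd (2 ^ r - 1) :=
    Nat.Even.sub_odd hr0 (even_two.pow_of_ne_zero (by omega)) odd_one
  have h1 : 1 ^ 2 + (2 ^ r - 1) ^ 1 = 2 ^ (r - 2 + 2) := by
    rw [show r - 2 + 2 = r by omega, pow_one]
    omega
  rcases isExceptional_or_eq hDo hn (by omega) h h1 with h2 | h2 | h2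
  · rw [isExceptional_two_pow_sub_one_iff hr] at h2
    subst h2
    right
    obtain ⟨-, s, rfl⟩ := eight_dvd_and_odd_of_solution hDo hn h
    have hs : s = 0 := by
      by_contra hs
      have hle : 2 ^ (r - 1) ≤ 2 ^ r - 1 := by
        have : 2 ^ r = 2 ^ (r - 1) * 2 := by rw [← pow_succ]; congr 1; omega
        omega
      have h3 : (2 ^ (r - 1)) ^ (2 * s + 1) ≤ 2 ^ (2 * r - 4 + 2) :=
        (Nat.pow_le_pow_left hle _).trans (by omega)
      rw [← pow_mul] at h3
      have h4 := (Nat.pow_le_pow_iff_right (by norm_num)).1 h3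
      have h5 : (r - 1) * 3 ≤ (r - 1) * (2 * s + 1) := Nat.mul_le_mul_left _ (by omega)
      omega
    subst hs
    refine ⟨Nat.pow_left_injective two_ne_zero ?_, rfl, rfl⟩
    have h3 := sq_add_two_pow_sub_one (show 2 ≤ r by omega)
    rw [mul_zero, zero_add, pow_one] at h
    simp only
    omega
  · rw [isExceptional_two_pow_sub_one_iff hr] at h2
    omega
  · exact Or.inl h2

/-- If `D₁ = 1`, then the number of positive solutions `(x, m, n)` of
`x² + D₂^m = 2^(n+2)` is at most `1`, except that it is `6` for `D₂ = 7`,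
`2` for `D₂ = 23`, and `2` for `D₂ = 2^r - 1` with `r > 3`. -/
theorem stmt_0 (D₂ : ℕ) (hD₂odd : Odd D₂) (hD₂ : 1 < D₂) :
    let S : Set (ℕ × ℕ × ℕ) :=
      {p | 0 < p.1 ∧ 0 < p.2.1 ∧ 0 < p.2.2 ∧
        1 * p.1 ^ 2 + D₂ ^ p.2.1 = 2 ^ (p.2.2 + 2)}
    (D₂ = 7 → S.ncard = 6) ∧
    (D₂ = 23 → S.ncard = 2) ∧
    ((∃ r : ℕ, 3 < r ∧ D₂ = 2 ^ r - 1) → S.ncard = 2) ∧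
    (D₂ ≠ 7 → D₂ ≠ 23 → (¬ ∃ r : ℕ, 3 < r ∧ D₂ = 2 ^ r - 1) →
      S.Finite ∧ S.ncard ≤ 1) := by
  intro S
  have hS : ∀ x m n, (x, m, n) ∈ S ↔ 0 < x ∧ 0 < m ∧ 0 < n ∧ x ^ 2 + D₂ ^ m = 2 ^ (n + 2) := by
    intro x m n
    simp [S]
  refine ⟨?_, ?_, ?_, ?_⟩
  · rintro rfl
    have h : S = (({(1, 1, 1), (3, 1, 2), (5, 1, 3), (11, 1, 5), (13, 3, 7), (181, 1, 13)} :
        Finset (ℕ × ℕ × ℕ)) : Set (ℕ × ℕ × ℕ)) := by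
      ext ⟨x, m, n⟩
      simp only [hS, coe_insert, coe_singleton, Set.mem_insert_iff, Set.mem_singleton_iff,
        Prod.mk.injEq]
      refine ⟨fun ⟨hx, _, hn, h⟩ => solutions_seven hx hn h, ?_⟩
      rintro (⟨rfl, rfl, rfl⟩ | ⟨rfl, rfl, rfl⟩ | ⟨rfl, rfl, rfl⟩ | ⟨rfl, rfl, rfl⟩ |
        ⟨rfl, rfl, rfl⟩ | ⟨rfl, rfl, rfl⟩) <;> norm_num
    rw [h, Set.ncard_coe_finset]
    rfl
  · rintro rfl
    have h : S = {(3, 1, 3), (45, 1, 9)} := by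
      ext ⟨x, m, n⟩
      simp only [hS, Set.mem_insert_iff, Set.mem_singleton_iff, Prod.mk.injEq]
      refine ⟨fun ⟨hx, _, hn, h⟩ => solutions_twentythree hx hn h, ?_⟩
      rintro (⟨rfl, rfl, rfl⟩ | ⟨rfl, rfl, rfl⟩) <;> norm_num
    rw [h, Set.ncard_pair (by decide)]
  · rintro ⟨r, hr, rfl⟩
    have h : S = {(1, 1, r - 2), (2 ^ (r - 1) - 1, 1, 2 * r - 4)} := by
      ext ⟨x, m, n⟩
      simp only [hS, Set.mem_insert_iff, Set.mem_singleton_iff, Prod.mk.injEq]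
      refine ⟨fun ⟨_, _, hn, h⟩ => solutions_two_pow_sub_one hr hn h, ?_⟩
      rintro (⟨rfl, rfl, rfl⟩ | ⟨rfl, rfl, rfl⟩)
      · refine ⟨one_pos, one_pos, by omega, ?_⟩
        have := Nat.two_pow_pos r
        rw [show r - 2 + 2 = r by omega, pow_one]
        omega
      · have : 2 ^ 1 ≤ 2 ^ (r - 1) := Nat.pow_le_pow_right (by norm_num) (by omega)
        refine ⟨by omega, one_pos, by omega, ?_⟩
        rw [pow_one]
        exact sq_add_two_pow_sub_one (by omega)
    rw [h, Set.ncard_pair]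
    simp only [ne_eq, Prod.mk.injEq, not_and]
    omega
  · intro h7 h23 hr
    have hexc : ∀ n, ¬ IsExceptional D₂ n := by
      rintro n (⟨h, -⟩ | ⟨h, -⟩ | ⟨r, h, h', -⟩)
      · exact h7 h
      · exact h23 h
      · exact hr ⟨r, h, h'⟩
    have hsub : S.Subsingleton := by
      rintro ⟨x, m, n⟩ hp ⟨x', m', n'⟩ hp'
      obtain ⟨-, -, hn, h⟩ := (hS x m n).1 hp
      obtain ⟨-, -, hn', h'⟩ := (hS x' m' n').1 hp'
      rcases isExceptional_or_eq hD₂odd hn hn' h h' with h1 | h1 | ⟨rfl, rfl, rfl⟩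
      · exact absurd h1 (hexc _)
      · exact absurd h1 (hexc _)
      · rfl
    exact ⟨hsub.finite, (Set.ncard_le_one hsub.finite).2 fun _ ha _ hb => hsub ha hb⟩
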